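/- If H is a graph and v is a vertex of H of degree at most 4 such that H − v is planar and triangle-free, then H is 3-colorable. -/

import Mathlib

universe u
variable {V : Type u}



/-- A topological embedding (drawing) of a simple graph in a topological space `X`:
vertices map to distinct points, edges map to arcs meeting only at common endpoints. -/
structure GraphEmbeddingIn (X : Type*) [TopologicalSpace X] (G : SimpleGraph V) where
  vertexPos : V → X
  vertexInj : Function.Injective vertexPos
  edgeArc : ∀ u v : V, G.Adj u v → ℝ → X
  arc_cont : ∀ u v h, ContinuousOn (edgeArc u v h) (Set.Icc 0 1)
  arc_injOn : ∀ u v h, Set.InjOn (edgeArc u v h) (Set.Icc 0 1)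
  arc_start : ∀ u v h, edgeArc u v h 0 = vertexPos u
  arc_end : ∀ u v h, edgeArc u v h 1 = vertexPos v
  arc_avoid : ∀ u v h (w : V), vertexPos w ∉ edgeArc u v h '' Set.Ioo 0 1
  arc_disjoint : ∀ u v h u' v' h', s(u, v) ≠ s(u', v') →
    edgeArc u v h '' Set.Ioo 0 1 ∩ edgeArc u' v' h' '' Set.Icc 0 1 = ∅

/-- A graph is planar if it has a drawing in the plane. -/
def SimpleGraph.IsPlanar (G : SimpleGraph V) : Prop :=
  Nonempty (GraphEmbeddingIn (ℝ × ℝ) G)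


section CriticalBound

open Finset
open scoped Classical

namespace SimpleGraph

/-- `G` has a map to three colors that is proper on the finite vertex set `S`. -/
def ColorableOn (G : SimpleGraph V) (S : Finset V) : Prop :=
  ∃ c : V → Fin 3, ∀ a ∈ S, ∀ b ∈ S, G.Adj a b → c a ≠ c b

/-- The induced subgraph on `S` is not 3-colorable, but every proper induced subgraph is. -/
def CriticalOn (G : SimpleGraph V) (S : Finset V) : Prop :=
  ¬ G.ColorableOn S ∧ ∀ T ⊂ S, G.ColorableOn T

/-- The number of pairs in `A × B` that are adjacent. -/
noncomputable def adjCount (G : SimpleGraph V) (A B : Finset V) : ℤ :=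
  ∑ a ∈ A, ∑ b ∈ B, if G.Adj a b then 1 else 0

/-- Twice the Kostochka–Yancey potential `5 |S| - 3 |E(G[S])|`. -/
noncomputable def potential (G : SimpleGraph V) (S : Finset V) : ℤ :=
  10 * #S - 3 * G.adjCount S S

variable {G : SimpleGraph V} {S R T A B : Finset V}

theorem ColorableOn.mono (h : G.ColorableOn S) (hT : T ⊆ S) : G.ColorableOn T := by
  obtain ⟨c, hc⟩ := h
  exact ⟨c, fun a ha b hb => hc a (hT ha) b (hT hb)⟩

theorem ColorableOn.of_le {G' : SimpleGraph V} (h : G.ColorableOn S)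
    (hG : ∀ a ∈ S, ∀ b ∈ S, G'.Adj a b → G.Adj a b) : G'.ColorableOn S := by
  obtain ⟨c, hc⟩ := h
  exact ⟨c, fun a ha b hb hab => hc a ha b hb (hG a ha b hb hab)⟩

theorem exists_criticalOn (h : ¬ G.ColorableOn S) : ∃ T ⊆ S, G.CriticalOn T := by
  induction S using Finset.strongInduction with
  | H S ih =>
    by_cases hS : ∀ T ⊂ S, G.ColorableOn T
    · exact ⟨S, Subset.rfl, h, hS⟩
    · push Not at hS
      obtain ⟨T, hT, hc⟩ := hS
      obtain ⟨T', hT', hc'⟩ := ih T hT hc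
      exact ⟨T', hT'.trans hT.subset, hc'⟩

theorem adjCount_comm (A B : Finset V) : G.adjCount A B = G.adjCount B A := by
  unfold adjCount
  rw [sum_comm]
  simp only [G.adj_comm]

theorem adjCount_nonneg : 0 ≤ G.adjCount A B :=
  sum_nonneg fun _ _ => sum_nonneg fun _ _ => by split_ifs <;> simp

theorem adjCount_union_left (C : Finset V) (h : Disjoint A B) :
    G.adjCount (A ∪ B) C = G.adjCount A C + G.adjCount B C :=
  sum_union h

theorem adjCount_union_right (C : Finset V) (h : Disjoint A B) :
    G.adjCount C (A ∪ B) = G.adjCount C A + G.adjCount C B := by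
  rw [adjCount_comm, adjCount_union_left C h, adjCount_comm A, adjCount_comm B]

theorem adjCount_pos {a b : V} (ha : a ∈ A) (hb : b ∈ B) (hab : G.Adj a b) :
    1 ≤ G.adjCount A B := by
  unfold adjCount
  calc (1 : ℤ) = if G.Adj a b then 1 else 0 := by simp [hab]
    _ ≤ ∑ b ∈ B, if G.Adj a b then 1 else 0 :=
        single_le_sum (f := fun b => if G.Adj a b then (1 : ℤ) else 0)
          (fun _ _ => by split_ifs <;> simp) hb
    _ ≤ _ := single_le_sum (f := fun a => ∑ b ∈ B, if G.Adj a b then (1 : ℤ) else 0)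
          (fun _ _ => sum_nonneg fun _ _ => by split_ifs <;> simp) ha

theorem adjCount_congr {G' : SimpleGraph V}
    (h : ∀ a ∈ A, ∀ b ∈ B, (G.Adj a b ↔ G'.Adj a b)) : G.adjCount A B = G'.adjCount A B :=
  sum_congr rfl fun a ha => sum_congr rfl fun b hb => by simp [h a ha b hb]

theorem adjCount_eq_sum_card : G.adjCount A B = ∑ a ∈ A, (#{b ∈ B | G.Adj a b} : ℤ) := by
  simp [adjCount]

theorem adjCount_le_card_mul_sub : G.adjCount S S ≤ #S * (#S - 1 : ℤ) := by
  rw [adjCount_eq_sum_card]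
  calc _ ≤ ∑ a ∈ S, (#S - 1 : ℤ) := sum_le_sum fun a ha => by
        have : #{b ∈ S | G.Adj a b} ≤ #(S.erase a) := card_le_card fun b hb => by
          simp only [mem_filter] at hb
          exact mem_erase.2 ⟨hb.2.ne', hb.1⟩
        rw [card_erase_of_mem ha] at this
        have h1 : 1 ≤ #S := card_pos.2 ⟨a, ha⟩
        omega
    _ = _ := by rw [sum_const, nsmul_eq_mul]

theorem potential_union (h : Disjoint A B) :
    G.potential (A ∪ B) = G.potential A + G.potential B - 6 * G.adjCount A B := by
  simp only [potential, card_union_of_disjoint h, adjCount_union_left _ h,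
    adjCount_union_right _ h, adjCount_comm B A]
  push_cast; ring

theorem le_potential (S : Finset V) : 13 * #S - 3 * #S ^ 2 ≤ G.potential S := by
  have := G.adjCount_le_card_mul_sub (S := S)
  unfold potential
  nlinarith

theorem four_le_card_of_not_colorableOn (h : ¬ G.ColorableOn S) : 4 ≤ #S := by
  by_contra! hlt
  apply h
  obtain ⟨f⟩ : Nonempty (S ↪ Fin 3) := by
    rw [Function.Embedding.nonempty_iff_card_le]
    simpa using Nat.le_of_lt_succ hlt
  refine ⟨fun a => if ha : a ∈ S then f ⟨a, ha⟩ else 0, fun a ha b hb hab => ?_⟩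
  simp [ha, hb, hab.ne]

/-- Collapse each color class of `φ` on `R` to a single vertex, making the results adjacent.
The collapsed class is represented by any of its members. -/
def collapse (G : SimpleGraph V) (R : Finset V) (φ : V → Fin 3) : SimpleGraph V where
  Adj a b := a ≠ b ∧ ((a ∈ R ∧ b ∈ R) ∨ (a ∉ R ∧ b ∉ R ∧ G.Adj a b) ∨
    (a ∉ R ∧ b ∈ R ∧ ∃ w ∈ R, φ w = φ b ∧ G.Adj a w) ∨
    (a ∈ R ∧ b ∉ R ∧ ∃ w ∈ R, φ w = φ a ∧ G.Adj b w))
  symm := ⟨by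
    rintro a b ⟨hne, h⟩
    refine ⟨hne.symm, ?_⟩
    rw [G.adj_comm b a]
    rcases h with h | h | h | h
    · exact Or.inl h.symm
    · exact Or.inr (Or.inl ⟨h.2.1, h.1, h.2.2⟩)
    · exact Or.inr (Or.inr (Or.inr ⟨h.2.1, h.1, h.2.2⟩))
    · exact Or.inr (Or.inr (Or.inl ⟨h.2.1, h.1, h.2.2⟩))⟩
  loopless := ⟨fun a h => h.1 rfl⟩

theorem collapse_adj_out {φ : V → Fin 3} {a b : V} (ha : a ∉ R) (hb : b ∉ R) :
    (G.collapse R φ).Adj a b ↔ G.Adj a b := by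
  have : G.Adj a b → a ≠ b := fun h => h.ne
  simp only [collapse]; tauto

theorem collapse_adj_mixed {φ : V → Fin 3} {a b : V} (ha : a ∉ R) (hb : b ∈ R) :
    (G.collapse R φ).Adj a b ↔ ∃ w ∈ R, φ w = φ b ∧ G.Adj a w := by
  have : a ≠ b := by rintro rfl; exact ha hb
  simp [collapse, ha, hb, this]

theorem collapse_adj_in {φ : V → Fin 3} {a b : V} (ha : a ∈ R) (hb : b ∈ R) (h : a ≠ b) :
    (G.collapse R φ).Adj a b := by
  simp only [collapse]; tauto

theorem ColorableOn.of_collapse {φ : V → Fin 3} {X : Finset V}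
    (hφ : ∀ a ∈ R, ∀ b ∈ R, G.Adj a b → φ a ≠ φ b) (hX : X ⊆ R)
    (hXR : X.image φ = R.image φ) (h : (G.collapse R φ).ColorableOn ((S \ R) ∪ X)) :
    G.ColorableOn S := by
  obtain ⟨c, hc⟩ := h
  have hk : ∀ v ∈ R, ∃ x ∈ X, φ x = φ v := fun v hv => by
    have : φ v ∈ X.image φ := hXR ▸ mem_image_of_mem φ hv
    simpa using this
  choose! k hkX hkφ using hk
  have out : ∀ a ∈ S, ∀ b ∈ R, a ∉ R → G.Adj a b → c a ≠ c (k b) := fun a ha b hb haR hab =>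
    hc a (mem_union_left _ (mem_sdiff.2 ⟨ha, haR⟩)) (k b) (mem_union_right _ (hkX b hb))
      ((collapse_adj_mixed haR (hX (hkX b hb))).2 ⟨b, hb, (hkφ b hb).symm, hab⟩)
  refine ⟨fun v => if v ∈ R then c (k v) else c v, fun a ha b hb hab => ?_⟩
  by_cases haR : a ∈ R <;> by_cases hbR : b ∈ R <;> simp only [haR, hbR, if_true, if_false]
  · refine hc _ (mem_union_right _ (hkX a haR)) _ (mem_union_right _ (hkX b hbR))
      (collapse_adj_in (hX (hkX a haR)) (hX (hkX b hbR)) fun he => hφ a haR b hbR hab ?_)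
    rw [← hkφ a haR, ← hkφ b hbR, he]
  · exact (out b hb a haR hbR hab.symm).symm
  · exact out a ha b hbR haR hab
  · exact hc a (by simp [ha, haR]) b (by simp [hb, hbR]) ((collapse_adj_out haR hbR).2 hab)

theorem adjCount_collapse_le {φ : V → Fin 3} {T₁ T₀ : Finset V} (h₁ : ∀ a ∈ T₁, a ∉ R)
    (h₀ : T₀ ⊆ R) (hinj : Set.InjOn φ T₀) :
    (G.collapse R φ).adjCount T₁ T₀ ≤ G.adjCount T₁ {w ∈ R | φ w ∈ T₀.image φ} := by
  simp only [adjCount_eq_sum_card]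
  refine sum_le_sum fun a ha => ?_
  have key : ∀ b ∈ ({b ∈ T₀ | (G.collapse R φ).Adj a b} : Finset V),
      ∃ w ∈ R, φ w = φ b ∧ G.Adj a w := fun b hb => by
    simp only [mem_filter] at hb
    exact (collapse_adj_mixed (h₁ a ha) (h₀ hb.1)).1 hb.2
  choose! f hfR hfφ hfa using key
  refine Nat.cast_le.2 (card_le_card_of_injOn f (fun b hb => ?_) fun b hb b' hb' he => ?_)
  · have hb' := (mem_filter.1 hb).1
    simp only [coe_filter, Set.mem_ofPred_eq, mem_filter]
    exact ⟨⟨hfR b hb, by rw [hfφ b hb]; exact mem_image_of_mem φ hb'⟩, hfa b hb⟩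
  · exact hinj (mem_filter.1 hb).1 (mem_filter.1 hb').1 (by rw [← hfφ b hb, he, hfφ b' hb'])

/-- Every critical vertex set with fewer than `n` vertices has small potential. -/
def CriticalBoundBelow (V : Type u) (n : ℕ) : Prop :=
  ∀ (G : SimpleGraph V) (T : Finset V), #T < n → G.CriticalOn T → G.potential T ≤ 4

theorem CriticalBoundBelow.exists_subset {n : ℕ} (ih : CriticalBoundBelow V n)
    (hn : #S < n) (h : ¬ G.ColorableOn S) :
    ∃ T ⊆ S, ¬ G.ColorableOn T ∧ G.potential T ≤ 4 := by
  obtain ⟨T, hT, hc⟩ := exists_criticalOn h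
  exact ⟨T, hT, hc.1, ih G T ((card_le_card hT).trans_lt hn) hc⟩

theorem CriticalOn.exists_extension (hS : G.CriticalOn S) (ih : CriticalBoundBelow V #S)
    (hR : R ⊆ S) (h4 : 4 ≤ #R) {φ : V → Fin 3}
    (hφ : ∀ a ∈ R, ∀ b ∈ R, G.Adj a b → φ a ≠ φ b) :
    ∃ T ⊆ S \ R, ∃ I : Finset (Fin 3), I.Nonempty ∧ G.potential (T ∪ R) ≤
      G.potential R + 4 - (13 * #I - 3 * #I ^ 2) - 6 * G.adjCount T {w ∈ R | φ w ∉ I} := by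
  obtain ⟨X, hX, hinj, hXR⟩ := exists_subset_injOn_image_eq_of_surjOn (f := φ) R (R.image φ)
    (by intro x hx; simpa using hx)
  have hX : X ⊆ R := by exact_mod_cast hX
  have hcard : #X ≤ 3 := by
    rw [← card_image_of_injOn hinj]; simpa using card_le_univ (X.image φ)
  have hdisj : Disjoint (S \ R) X := disjoint_sdiff_self_left.mono_right hX
  have hlt : #((S \ R) ∪ X) < #S := by
    rw [card_union_of_disjoint hdisj, card_sdiff_of_subset hR]
    have := card_le_card hR
    omega
  obtain ⟨T, hT, hTc, hTp⟩ := ih.exists_subset hlt fun h => hS.1 (h.of_collapse hφ hX hXR)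
  have hT1 : T \ R ⊆ S \ R := fun a ha => by
    have := hT (mem_sdiff.1 ha).1
    simp only [mem_union, mem_sdiff] at this ha ⊢
    rcases this with h | h
    · exact h
    · exact absurd (hX h) ha.2
  have hT0 : T ∩ R ⊆ X := fun a ha => by
    have := hT (mem_inter.1 ha).1
    simp only [mem_union, mem_sdiff, mem_inter] at this ha
    tauto
  have hne : (T ∩ R).Nonempty := by
    rw [nonempty_iff_ne_empty]
    intro he
    have hTR : ∀ a ∈ T, a ∉ R := fun a ha haR => by
      have := mem_inter.2 ⟨ha, haR⟩
      simp [he] at this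
    have hTS : T ⊆ S \ R := fun a ha => hT1 (mem_sdiff.2 ⟨ha, hTR a ha⟩)
    obtain ⟨r, hr⟩ : R.Nonempty := card_pos.1 (by omega)
    have hss : T ⊂ S := ⟨hTS.trans sdiff_subset, fun h => hTR r (h (hR hr)) hr⟩
    exact hTc ((hS.2 T hss).of_le fun a ha b hb =>
      (collapse_adj_out (hTR a ha) (hTR b hb)).1)
  have hinj0 : Set.InjOn φ (T ∩ R : Finset V) := hinj.mono (by exact_mod_cast hT0)
  refine ⟨T \ R, hT1, (T ∩ R).image φ, hne.image φ, ?_⟩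
  have hdT : Disjoint (T \ R) (T ∩ R) := disjoint_sdiff_self_left.mono_right inter_subset_right
  have e1 : (G.collapse R φ).potential T = (G.collapse R φ).potential (T \ R) +
      (G.collapse R φ).potential (T ∩ R) - 6 * (G.collapse R φ).adjCount (T \ R) (T ∩ R) := by
    rw [← potential_union hdT, sdiff_union_inter]
  have e2 : (G.collapse R φ).potential (T \ R) = G.potential (T \ R) := by
    unfold potential
    rw [adjCount_congr fun a ha b hb => collapse_adj_out (mem_sdiff.1 ha).2 (mem_sdiff.1 hb).2]
  have e3 := (G.collapse R φ).le_potential (T ∩ R)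
  have e4 := adjCount_collapse_le (G := G) (φ := φ) (R := R) (T₁ := T \ R) (T₀ := T ∩ R)
    (fun a ha => (mem_sdiff.1 ha).2) inter_subset_right hinj0
  have e5 : G.adjCount (T \ R) R = G.adjCount (T \ R) {w ∈ R | φ w ∈ (T ∩ R).image φ} +
      G.adjCount (T \ R) {w ∈ R | φ w ∉ (T ∩ R).image φ} := by
    rw [← adjCount_union_right _ (disjoint_filter_filter_not _ _ _), filter_union_filter_not_eq]
  rw [potential_union disjoint_sdiff_self_left, card_image_of_injOn hinj0]
  linarith

theorem CriticalOn.lt_potential (hS : G.CriticalOn S) (ih : CriticalBoundBelow V #S)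
    (hp : 4 < G.potential S) (hR : R ⊂ S) (h2 : 2 ≤ #R) : 10 < G.potential R := by
  by_contra! hle
  have hfam : R ∈ {R ∈ S.powerset | R ≠ S ∧ 2 ≤ #R} := by
    simp [hR.subset, hR.ne, h2]
  obtain ⟨Q, hQ, hmin⟩ := exists_min_image {R ∈ S.powerset | R ≠ S ∧ 2 ≤ #R} G.potential ⟨R, hfam⟩
  simp only [mem_filter, mem_powerset] at hQ hmin
  have hQ10 := (hmin R (by simpa using hfam)).trans hle
  have hQ4 : 4 ≤ #Q := by
    by_contra! h
    have := G.le_potential Q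
    have h2 := hQ.2.2
    interval_cases hq : #Q <;> norm_num at this <;> omega
  obtain ⟨φ, hφ⟩ := hS.2 Q (hQ.1.ssubset_of_ne hQ.2.1)
  obtain ⟨T, hT, I, hI, hpot⟩ := hS.exists_extension ih hQ.1 hQ4 hφ
  have hI3 : #I ≤ 3 := by simpa using card_le_univ I
  have hI1 : 1 ≤ #I := card_pos.2 hI
  have hnn := G.adjCount_nonneg (A := T) (B := {w ∈ Q | φ w ∉ I})
  have h10 : (10 : ℤ) ≤ 13 * #I - 3 * #I ^ 2 := by interval_cases #I <;> norm_num
  by_cases hTQ : T ∪ Q = S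
  · rw [hTQ] at hpot; linarith
  · have := hmin (T ∪ Q) ⟨union_subset (hT.trans sdiff_subset) hQ.1, hTQ,
      hQ.2.2.trans (card_le_card subset_union_right)⟩
    linarith

theorem CriticalOn.exists_two_boundary (hS : G.CriticalOn S) (hR : R ⊂ S) (h2 : 2 ≤ #R) :
    ∃ a ∈ R, ∃ b ∈ R, a ≠ b ∧ (∃ w ∈ S \ R, G.Adj w a) ∧ ∃ w ∈ S \ R, G.Adj w b := by
  by_contra! hcon
  obtain ⟨u, hu, hub⟩ : ∃ u ∈ R, ∀ b ∈ R, b ≠ u → ∀ w ∈ S \ R, ¬ G.Adj w b := by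
    by_cases h : ∃ u ∈ R, ∃ w ∈ S \ R, G.Adj w u
    · obtain ⟨u, hu, hw⟩ := h
      exact ⟨u, hu, fun b hb hbu w hw' => hcon u hu b hb hbu.symm hw w hw'⟩
    · push Not at h
      obtain ⟨u, hu⟩ : R.Nonempty := card_pos.1 (by omega)
      exact ⟨u, hu, fun b hb _ w hw => h b hb w hw⟩
  obtain ⟨c, hc⟩ := hS.2 R hR
  obtain ⟨u', hu', hne⟩ := exists_mem_ne (by omega : 1 < #R) u
  obtain ⟨c', hc'⟩ := hS.2 (insert u (S \ R)) ⟨insert_subset (hR.subset hu) sdiff_subset,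
    fun h => by have := h (hR.subset hu'); simp [hne, hu'] at this⟩
  have cross : ∀ a ∈ R, ∀ b ∈ S, b ∉ R → G.Adj b a → c a ≠ Equiv.swap (c' u) (c u) (c' b) := by
    intro a ha b hb hbR hba
    have hau : a = u := by
      by_contra h
      exact hub a ha h b (by simp [hb, hbR]) hba
    subst hau
    intro he
    have h1 := hc' b (by simp [hb, hbR]) a (by simp) hba
    apply h1
    apply (Equiv.swap (c' a) (c a)).injective
    rw [← he, Equiv.swap_apply_left]
  apply hS.1
  refine ⟨fun v => if v ∈ R then c v else Equiv.swap (c' u) (c u) (c' v), fun a ha b hb hab => ?_⟩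
  by_cases haR : a ∈ R <;> by_cases hbR : b ∈ R <;> simp only [haR, hbR, if_true, if_false]
  · exact hc a haR b hbR hab
  · exact cross a haR b hb hbR hab.symm
  · exact (cross b hbR a ha haR hab).symm
  · simpa using hc' a (by simp [ha, haR]) b (by simp [hb, hbR]) hab

theorem adjCount_sup_edge_le {a b : V} :
    (G ⊔ edge a b).adjCount S S ≤ G.adjCount S S + 2 := by
  obtain ⟨G', hG'⟩ : ∃ G', G' = G ⊔ edge a b := ⟨_, rfl⟩
  rw [← hG']
  have h : ∀ x y, (if G'.Adj x y then (1 : ℤ) else 0) ≤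
      (if G.Adj x y then 1 else 0) + ((if x = a then if y = b then 1 else 0 else 0) +
        (if x = b then if y = a then 1 else 0 else 0)) := by
    intro x y
    simp only [hG', sup_adj, edge_adj]
    split_ifs <;> first | omega | (exfalso; tauto)
  calc G'.adjCount S S ≤ ∑ x ∈ S, ∑ y ∈ S, _ :=
        sum_le_sum fun x _ => sum_le_sum fun y _ => h x y
    _ ≤ _ := by
        have : ∀ p q : V, ∑ x ∈ S, ∑ y ∈ S,
            (if x = p then if y = q then (1 : ℤ) else 0 else 0) ≤ 1 := fun p q => by
          have : ∀ x ∈ S, ∑ y ∈ S, (if x = p then if y = q then (1 : ℤ) else 0 else 0) ≤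
              if x = p then 1 else 0 := fun x _ => by
            by_cases hx : x = p
            · simp only [hx, if_true, sum_ite_eq']
              split_ifs <;> simp
            · simp [hx]
          refine (sum_le_sum this).trans ?_
          rw [sum_ite_eq']
          split_ifs <;> simp
        simp only [sum_add_distrib]
        have h1 := this a b
        have h2 := this b a
        unfold adjCount
        linarith

/-- An edge may be added inside a vertex set all of whose subsets have large potential. -/
theorem CriticalOn.colorableOn_sup_edge (hS : G.CriticalOn S) (ih : CriticalBoundBelow V #S)
    (hp : 4 < G.potential S) (hR : R ⊂ S) (a b : V) : (G ⊔ edge a b).ColorableOn R := by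
  by_contra h
  obtain ⟨T, hT, hTc, hTp⟩ := ih.exists_subset (card_lt_card hR) h
  have h4 := four_le_card_of_not_colorableOn hTc
  have := hS.lt_potential ih hp (hT.trans_ssubset hR) (by omega)
  have := G.adjCount_sup_edge_le (S := T) (a := a) (b := b)
  unfold potential at *
  linarith

theorem CriticalOn.lt_potential_of_four_le (hS : G.CriticalOn S)
    (ih : CriticalBoundBelow V #S) (hp : 4 < G.potential S) (hR : R ⊂ S) (h4 : 4 ≤ #R) :
    12 < G.potential R := by
  by_contra! hle
  obtain ⟨a, ha, b, hb, hab, ⟨wa, hwa, hwa'⟩, ⟨wb, hwb, hwb'⟩⟩ :=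
    hS.exists_two_boundary hR (by omega)
  obtain ⟨φ, hφ⟩ := hS.colorableOn_sup_edge ih hp hR a b
  have hφab : φ a ≠ φ b := hφ a ha b hb (by simp [edge_adj, hab])
  obtain ⟨T, hT, I, hI, hpot⟩ := hS.exists_extension ih hR.subset h4
    (fun x hx y hy hxy => hφ x hx y hy (Or.inl hxy))
  have hI3 : #I ≤ 3 := by simpa using card_le_univ I
  have hI1 : 1 ≤ #I := card_pos.2 hI
  have hnn := G.adjCount_nonneg (A := T) (B := {w ∈ R | φ w ∉ I})
  by_cases hTR : T ∪ R = S
  · have hTeq : T = S \ R := by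
      refine hT.antisymm fun x hx => ?_
      rw [← hTR] at hx
      simp only [mem_sdiff, mem_union] at hx
      tauto
    rw [hTR] at hpot
    have : #I = 1 ∨ #I = 2 ∨ #I = 3 := by omega
    rcases this with h | h | h
    · obtain ⟨i, rfl⟩ := card_eq_one.1 h
      have : 1 ≤ G.adjCount T {w ∈ R | φ w ∉ ({i} : Finset (Fin 3))} := by
        by_cases hi : φ a = i
        · refine adjCount_pos (hTeq ▸ hwb) ?_ hwb'
          simp only [mem_filter, mem_singleton]
          exact ⟨hb, fun h => hφab (hi.trans h.symm)⟩
        · refine adjCount_pos (hTeq ▸ hwa) ?_ hwa'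
          simpa using ⟨ha, hi⟩
      rw [h] at hpot
      push_cast at hpot
      linarith
    all_goals rw [h] at hpot; push_cast at hpot; linarith
  · have h10 : (10 : ℤ) ≤ 13 * #I - 3 * #I ^ 2 := by interval_cases #I <;> norm_num
    have := hS.lt_potential ih hp
      ((union_subset (hT.trans sdiff_subset) hR.subset).ssubset_of_ne hTR)
      ((by omega : 2 ≤ #R).trans (card_le_card subset_union_right))
    linarith

end SimpleGraph
end CriticalBound

section CriticalBoundProof

open Finset
open scoped Classical

namespace SimpleGraph

variable {G : SimpleGraph V} {S : Finset V} {x y z : V}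

theorem update_proper {c : V → Fin 3} {p : Fin 3}
    (hc : ∀ a ∈ S.erase x, ∀ b ∈ S.erase x, G.Adj a b → c a ≠ c b)
    (hp : ∀ w ∈ S, G.Adj x w → c w ≠ p) :
    ∀ a ∈ S, ∀ b ∈ S, G.Adj a b → Function.update c x p a ≠ Function.update c x p b := by
  intro a ha b hb hab
  by_cases hax : a = x <;> by_cases hbx : b = x
  · exact absurd (hax.trans hbx.symm) hab.ne
  · subst hax
    simpa [hbx] using (hp b hb hab).symm
  · subst hbx
    simpa [hax] using hp a ha hab.symm
  · simpa [hax, hbx] using hc a (mem_erase.2 ⟨hax, ha⟩) b (mem_erase.2 ⟨hbx, hb⟩) hab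

theorem CriticalOn.three_le_degree (hS : G.CriticalOn S) (hx : x ∈ S) :
    3 ≤ #{w ∈ S | G.Adj x w} := by
  by_contra! hlt
  obtain ⟨c, hc⟩ := hS.2 (S.erase x) (erase_ssubset hx)
  obtain ⟨p, hp⟩ : ∃ p, p ∉ ({w ∈ S | G.Adj x w} : Finset V).image c := by
    by_contra! h
    have h1 : #(univ : Finset (Fin 3)) ≤ _ := card_le_card fun i _ => h i
    have h2 := h1.trans card_image_le
    simp only [card_univ, Fintype.card_fin] at h2
    omega
  refine hS.1 ⟨_, update_proper hc (p := p) fun w hw hxw he => hp ?_⟩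
  exact mem_image.2 ⟨w, by simp [hw, hxw], he⟩

theorem CriticalOn.five_le_card (hS : G.CriticalOn S) (hp : 4 < G.potential S) : 5 ≤ #S := by
  have h4 := four_le_card_of_not_colorableOn hS.1
  by_contra! hlt
  have h : #S = 4 := by omega
  have : (12 : ℤ) ≤ G.adjCount S S := by
    rw [adjCount_eq_sum_card]
    calc (12 : ℤ) = ∑ a ∈ S, 3 := by simp [h]
      _ ≤ _ := sum_le_sum fun a ha => by exact_mod_cast hS.three_le_degree ha
  unfold potential at hp
  rw [h] at hp
  push_cast at hp
  linarith

/-- A triangle of a potential counterexample has at most one vertex of degree three. -/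
theorem CriticalOn.not_triangle_of_degree_eq_three (hS : G.CriticalOn S)
    (ih : CriticalBoundBelow V #S) (hpot : 4 < G.potential S)
    (hx : x ∈ S) (hy : y ∈ S) (hz : z ∈ S) (hxy : G.Adj x y) (hxz : G.Adj x z) (hyz : G.Adj y z)
    (dx : #{w ∈ S | G.Adj x w} = 3) (dy : #{w ∈ S | G.Adj y w} = 3) : False := by
  have third : ∀ {x y : V}, y ∈ S → G.Adj x y → G.Adj x z → G.Adj y z →
      #{w ∈ S | G.Adj x w} = 3 →
      ∃ a ∈ S, G.Adj x a ∧ a ≠ y ∧ a ≠ z ∧ ∀ w ∈ S, G.Adj x w → w = y ∨ w = z ∨ w = a := by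
    intro x y hy hxy hxz hyz dx
    have hcard : #((({w ∈ S | G.Adj x w} : Finset V).erase y).erase z) = 1 := by
      rw [card_erase_of_mem (by simp [hz, hxz, hyz.ne']), card_erase_of_mem (by simp [hy, hxy]), dx]
    obtain ⟨a, ha⟩ := card_eq_one.1 hcard
    have ha' : a ∈ ((({w ∈ S | G.Adj x w} : Finset V).erase y).erase z) := by simp [ha]
    simp only [mem_erase, mem_filter] at ha'
    refine ⟨a, ha'.2.2.1, ha'.2.2.2, ha'.2.1, ha'.1, fun w hw hxw => ?_⟩
    by_contra! hne
    have : w ∈ ((({w ∈ S | G.Adj x w} : Finset V).erase y).erase z) := by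
      simp [hw, hxw, hne.1, hne.2.1]
    rw [ha, mem_singleton] at this
    exact hne.2.2 this
  obtain ⟨a, ha, hxa, hay, haz, hxN⟩ := third hy hxy hxz hyz dx
  obtain ⟨b, hb, hyb, hbx, hbz, hyN⟩ := third hx hxy.symm hyz hxz dy
  have h5 := hS.five_le_card hpot
  have hab : a ≠ b := by
    rintro rfl
    have hcard : #{x, y, z, a} = 4 := by
      simp [hxy.ne, hxz.ne, hyz.ne, hxa.ne, hay.symm, haz.symm]
    have hss : ({x, y, z, a} : Finset V) ⊂ S := by
      refine ssubset_of_subset_of_ne ?_ fun h => ?_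
      · simp [insert_subset_iff, hx, hy, hz, ha]
      · rw [h] at hcard; omega
    have := hS.lt_potential ih hpot hss (by omega)
    have : (10 : ℤ) ≤ G.adjCount {x, y, z, a} {x, y, z, a} := by
      unfold adjCount
      simp only [hxy.ne, hxz.ne, hyz.ne, hxa.ne, hay.symm, haz.symm, sum_insert, mem_insert,
        mem_singleton, not_false_eq_true, sum_singleton, hxy, hxz, hyz, hxa, hyb, hxy.symm,
        hxz.symm, hyz.symm, hxa.symm, hyb.symm, if_true, SimpleGraph.irrefl, if_false, or_self]
      split_ifs <;> norm_num
    unfold potential at *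
    rw [hcard] at *
    push_cast at *
    linarith
  obtain ⟨c, hc⟩ := hS.colorableOn_sup_edge ih hpot (R := (S.erase x).erase y)
    ((erase_subset _ _).trans_ssubset (erase_ssubset hx)) a b
  have hcab : c a ≠ c b := hc a (by simp [ha, hay, hxa.ne']) b (by simp [hb, hbx, hyb.ne'])
    (by simp [edge_adj, hab])
  obtain ⟨p, q, hpq, hpa, hpz, hqb, hqz⟩ : ∃ p q : Fin 3,
      p ≠ q ∧ p ≠ c a ∧ p ≠ c z ∧ q ≠ c b ∧ q ≠ c z := by
    generalize c a = i at *
    generalize c b = j at *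
    generalize c z = k at *
    revert i j k; decide
  refine hS.1 ⟨_, update_proper (p := p) (update_proper (p := q) (x := y)
    (fun s hs t ht hst => hc s hs t ht (Or.inl hst)) ?_) ?_⟩
  · intro w hw hyw
    rcases hyN w (mem_of_mem_erase hw) hyw with rfl | rfl | rfl
    · simp at hw
    · exact hqz.symm
    · exact hqb.symm
  · intro w hw hxw
    rcases hxN w hw hxw with rfl | rfl | rfl
    · simpa using hpq.symm
    · simpa [hyz.ne'] using hpz.symm
    · simpa [hay] using hpa.symm

/-- Identify `v` with `u`, keeping the name `u`. -/
def identify (G : SimpleGraph V) (u v : V) : SimpleGraph V where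
  Adj a b := a ≠ b ∧ (G.Adj a b ∨ (a = u ∧ G.Adj v b) ∨ (b = u ∧ G.Adj v a))
  symm := ⟨fun a b h => ⟨h.1.symm, by rw [G.adj_comm b a]; tauto⟩⟩
  loopless := ⟨fun _ h => h.1 rfl⟩

/-- Adjacent vertices of degree three in a potential counterexample lie in triangles. -/
theorem CriticalOn.exists_triangle_of_degree_eq_three (hS : G.CriticalOn S)
    (ih : CriticalBoundBelow V #S) (hpot : 4 < G.potential S)
    (hx : x ∈ S) (hy : y ∈ S) (hxy : G.Adj x y)
    (dx : #{w ∈ S | G.Adj x w} = 3) (dy : #{w ∈ S | G.Adj y w} = 3) :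
    ∃ a ∈ S, ∃ b ∈ S, G.Adj x a ∧ G.Adj x b ∧ G.Adj a b := by
  by_contra! hno
  have other : ∀ {x y : V}, y ∈ S → G.Adj x y → #{w ∈ S | G.Adj x w} = 3 →
      ∃ u v, u ≠ v ∧ u ≠ y ∧ v ≠ y ∧ u ∈ S ∧ v ∈ S ∧ G.Adj x u ∧ G.Adj x v ∧
        ∀ w ∈ S, G.Adj x w → w = y ∨ w = u ∨ w = v := by
    intro x y hy hxy dx
    have hcard : #(({w ∈ S | G.Adj x w} : Finset V).erase y) = 2 := by
      rw [card_erase_of_mem (by simp [hy, hxy]), dx]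
    obtain ⟨u, v, huv, he⟩ := card_eq_two.1 hcard
    have hu : u ∈ ({w ∈ S | G.Adj x w} : Finset V).erase y := by simp [he]
    have hv : v ∈ ({w ∈ S | G.Adj x w} : Finset V).erase y := by simp [he]
    simp only [mem_erase, mem_filter] at hu hv
    refine ⟨u, v, huv, hu.1, hv.1, hu.2.1, hv.2.1, hu.2.2, hv.2.2, fun w hw hxw => ?_⟩
    by_contra! hne
    have : w ∈ ({w ∈ S | G.Adj x w} : Finset V).erase y := by simp [hw, hxw, hne.1]
    rw [he] at this
    simp [hne.2.1, hne.2.2] at this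
  obtain ⟨u, v, huv, huy, hvy, hu, hv, hxu, hxv, hxN⟩ := other hy hxy dx
  obtain ⟨s, t, -, hsx, htx, hs, ht, hys, hyt, hyN⟩ := other hx hxy.symm dy
  have huv' : ¬ G.Adj u v := hno u hu v hv hxu hxv
  have hcard : #(((S.erase x).erase y).erase v) < #S := card_lt_card
    ((erase_subset _ _).trans_ssubset ((erase_subset _ _).trans_ssubset (erase_ssubset hx)))
  have hncol : ¬ (G.identify u v).ColorableOn (((S.erase x).erase y).erase v) := by
    rintro ⟨c, hc⟩
    have hc1 := update_proper (G := G) (S := (S.erase x).erase y) (x := v) (c := c) (p := c u)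
      (fun a ha b hb hab => hc a ha b hb ⟨hab.ne, Or.inl hab⟩) (fun w hw hvw => by
        have hwu : w ≠ u := by rintro rfl; exact huv' hvw.symm
        refine hc w (mem_erase.2 ⟨hvw.ne', hw⟩) u (by simp [huv, huy, hxu.ne', hu])
          ⟨hwu, Or.inr (Or.inr ⟨rfl, hvw⟩)⟩)
    set c1 := Function.update c v (c u) with hc1d
    obtain ⟨q, hqs, hqt⟩ : ∃ q : Fin 3, q ≠ c1 s ∧ q ≠ c1 t := by
      generalize c1 s = i
      generalize c1 t = j
      revert i j; decide
    have hc2 := update_proper (G := G) (S := S.erase x) (x := y) (c := c1) (p := q) hc1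
      (fun w hw hyw => by
        rcases hyN w (mem_of_mem_erase hw) hyw with rfl | rfl | rfl
        · simp at hw
        · exact hqs.symm
        · exact hqt.symm)
    obtain ⟨p, hpq, hpu⟩ : ∃ p : Fin 3, p ≠ q ∧ p ≠ c u := by
      generalize c u = i
      clear * - 
      revert q i; decide
    refine hS.1 ⟨_, update_proper (p := p) hc2 fun w hw hxw => ?_⟩
    rcases hxN w hw hxw with rfl | rfl | rfl
    · simpa using hpq.symm
    · simpa [huy, hc1d, huv] using hpu.symm
    · simpa [hvy, hc1d] using hpu.symm
  obtain ⟨T, hT, hTc, hTp⟩ := ih.exists_subset hcard hncol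
  have hTS : ∀ w ∈ T, w ≠ v ∧ w ≠ y ∧ w ≠ x ∧ w ∈ S := fun w hw => by
    simpa only [mem_erase] using hT hw
  have huT : u ∈ T := by
    by_contra huT
    refine hTc ((hS.2 T ⟨fun w hw => (hTS w hw).2.2.2, fun h => (hTS x (h hx)).2.2.1 rfl⟩).of_le ?_)
    intro a ha b hb hab
    rcases hab.2 with h | ⟨rfl, -⟩ | ⟨rfl, -⟩
    · exact h
    · exact absurd ha huT
    · exact absurd hb huT
  have pot_insert : ∀ (G : SimpleGraph V) (w : V) (A : Finset V), w ∉ A →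
      G.potential (insert w A) = 10 + G.potential A - 6 * #{b ∈ A | G.Adj w b} := by
    intro G w A hw
    rw [insert_eq, potential_union (disjoint_singleton_left.2 hw)]
    simp [potential, adjCount]
  set T₀ := T.erase u with hT₀
  have hTe : insert u T₀ = T := insert_erase huT
  have huT₀ : u ∉ T₀ := by simp [hT₀]
  have hvT : v ∉ insert u T₀ := by rw [hTe]; exact fun h => (hTS v h).1 rfl
  have hxT : x ∉ insert v (insert u T₀) := by
    rw [hTe, mem_insert, not_or]
    exact ⟨hxv.ne, fun h => (hTS x h).2.2.1 rfl⟩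
  have hyT : y ∉ insert x (insert v (insert u T₀)) := by
    rw [hTe, mem_insert, mem_insert, not_or, not_or]
    exact ⟨hxy.ne', hvy.symm, fun h => (hTS y h).2.1 rfl⟩
  have p1 := pot_insert (G.identify u v) u T₀ huT₀
  have p2 := pot_insert G u T₀ huT₀
  have p3 := pot_insert G v _ hvT
  have p4 := pot_insert G x _ hxT
  have p0 : (G.identify u v).potential T₀ = G.potential T₀ := by
    unfold potential
    rw [adjCount_congr fun a ha b hb => ?_]
    have hau : a ≠ u := by rintro rfl; exact huT₀ ha
    have hbu : b ≠ u := by rintro rfl; exact huT₀ hb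
    have : G.Adj a b → a ≠ b := fun h => h.ne
    simp only [identify, hau, hbu, false_and, or_false]
    tauto
  have k1 : #{b ∈ T₀ | (G.identify u v).Adj u b} ≤
      #{b ∈ T₀ | G.Adj u b} + #{b ∈ insert u T₀ | G.Adj v b} := by
    refine (card_le_card fun b hb => ?_).trans (card_union_le _ _)
    simp only [mem_filter, mem_union, identify, mem_insert] at hb ⊢
    have hbu : b ≠ u := by rintro rfl; exact huT₀ hb.1
    tauto
  have k2 : 2 ≤ #{b ∈ insert v (insert u T₀) | G.Adj x b} := by
    have : ({u, v} : Finset V) ⊆ {b ∈ insert v (insert u T₀) | G.Adj x b} := by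
      simp [insert_subset_iff, hxu, hxv]
    have h := card_le_card this
    rwa [card_pair huv] at h
  rw [hTe] at p1
  have hle : G.potential (insert x (insert v (insert u T₀))) ≤ 12 := by
    have k1' : (#{b ∈ T₀ | (G.identify u v).Adj u b} : ℤ) ≤
      #{b ∈ T₀ | G.Adj u b} + #{b ∈ insert u T₀ | G.Adj v b} := by exact_mod_cast k1
    have k2' : (2 : ℤ) ≤ #{b ∈ insert v (insert u T₀) | G.Adj x b} := by exact_mod_cast k2
    linarith
  have hRS : insert x (insert v (insert u T₀)) ⊂ S := by
    refine ⟨?_, fun h => hyT (h hy)⟩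
    rw [hTe, insert_subset_iff, insert_subset_iff]
    exact ⟨hx, hv, fun w hw => (hTS w hw).2.2.2⟩
  have h4 : 4 ≤ #(insert x (insert v (insert u T₀))) :=
    (four_le_card_of_not_colorableOn hTc).trans (card_le_card (by
      rw [hTe]; exact (subset_insert _ _).trans (subset_insert _ _)))
  exact absurd (hS.lt_potential_of_four_le ih hpot hRS h4) (by omega)

theorem CriticalOn.two_le_card_large_neighbors (hS : G.CriticalOn S)
    (ih : CriticalBoundBelow V #S) (hpot : 4 < G.potential S) (hx : x ∈ S)
    (dx : #{w ∈ S | G.Adj x w} = 3) :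
    2 ≤ #{w ∈ S | G.Adj x w ∧ #{b ∈ S | G.Adj w b} ≠ 3} := by
  by_cases h : ∃ y ∈ S, G.Adj x y ∧ #{b ∈ S | G.Adj y b} = 3
  · obtain ⟨y, hy, hxy, dy⟩ := h
    obtain ⟨a, ha, b, hb, hxa, hxb, hab⟩ :=
      hS.exists_triangle_of_degree_eq_three ih hpot hx hy hxy dx dy
    have hda : #{w ∈ S | G.Adj a w} ≠ 3 := fun da =>
      hS.not_triangle_of_degree_eq_three ih hpot hx ha hb hxa hxb hab dx da
    have hdb : #{w ∈ S | G.Adj b w} ≠ 3 := fun db =>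
      hS.not_triangle_of_degree_eq_three ih hpot hx hb ha hxb hxa hab.symm dx db
    have : ({a, b} : Finset V) ⊆ {w ∈ S | G.Adj x w ∧ #{b ∈ S | G.Adj w b} ≠ 3} := by
      simp [insert_subset_iff, ha, hb, hxa, hxb, hda, hdb]
    simpa [card_pair hab.ne] using card_le_card this
  · push Not at h
    have : ({w ∈ S | G.Adj x w ∧ #{b ∈ S | G.Adj w b} ≠ 3} : Finset V) = {w ∈ S | G.Adj x w} :=
      filter_congr fun w hw => ⟨fun h' => h'.1, fun h' => ⟨h', h w hw h'⟩⟩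
    rw [this, dx]
    norm_num

/-- The Kostochka–Yancey bound for 4-critical graphs. -/
theorem CriticalOn.potential_le (hS : G.CriticalOn S) : G.potential S ≤ 4 := by
  suffices H : ∀ n, CriticalBoundBelow V n from H (#S + 1) G S (Nat.lt_succ_self _) hS
  clear hS
  intro n
  induction n with
  | zero => intro G T h; simp at h
  | succ n ihn =>
    intro G S hcard hS
    have ih : CriticalBoundBelow V #S := fun G' T hT => ihn G' T (by omega)
    by_contra! hpot
    set L : Finset V := {v ∈ S | #{b ∈ S | G.Adj v b} = 3} with hL
    set B : Finset V := {v ∈ S | ¬ #{b ∈ S | G.Adj v b} = 3} with hB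
    have hdisj : Disjoint L B := disjoint_filter_filter_not _ _ _
    have hunion : L ∪ B = S := filter_union_filter_not_eq _ _
    have small : (20 * #L : ℤ) ≤ 6 * G.adjCount L S + G.adjCount L B := by
      rw [adjCount_eq_sum_card, adjCount_eq_sum_card, mul_sum, ← sum_add_distrib]
      calc (20 * #L : ℤ) = ∑ a ∈ L, 20 := by simp [mul_comm]
        _ ≤ _ := sum_le_sum fun a ha => by
          simp only [hL, mem_filter] at ha
          have h2 := hS.two_le_card_large_neighbors ih hpot ha.1 ha.2
          have : ({w ∈ S | G.Adj a w ∧ #{b ∈ S | G.Adj w b} ≠ 3} : Finset V) =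
              {b ∈ B | G.Adj a b} := by
            ext w; simp only [hB, mem_filter]; tauto
          rw [this] at h2
          rw [ha.2]
          push_cast
          have : (2 : ℤ) ≤ #{b ∈ B | G.Adj a b} := by exact_mod_cast h2
          linarith
    have large : (20 * #B : ℤ) ≤ 6 * G.adjCount B S - G.adjCount B L := by
      rw [adjCount_eq_sum_card, adjCount_eq_sum_card, mul_sum, ← sum_sub_distrib]
      calc (20 * #B : ℤ) = ∑ a ∈ B, 20 := by simp [mul_comm]
        _ ≤ _ := sum_le_sum fun a ha => by
          simp only [hB, mem_filter] at ha
          have h3 := hS.three_le_degree ha.1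
          have hle : #{b ∈ L | G.Adj a b} ≤ #{b ∈ S | G.Adj a b} :=
            card_le_card (filter_subset_filter _ (filter_subset _ _))
          have h4 : 4 ≤ #{b ∈ S | G.Adj a b} := by omega
          omega
    have hsum : G.adjCount S S = G.adjCount L S + G.adjCount B S := by
      rw [← adjCount_union_left S hdisj, hunion]
    have hc : (#S : ℤ) = #L + #B := by
      rw [← hunion, card_union_of_disjoint hdisj]; push_cast; rfl
    rw [adjCount_comm B L] at large
    unfold potential at hpot
    have h5 := hS.five_le_card hpot
    linarith

end SimpleGraph
end CriticalBoundProof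

section PlaneMaps

open Finset Equiv
open scoped Classical

/-- A finite combinatorial map with vertices labelled in `V`. Planarity is expressed by the
combinatorial Jordan property: the edges of every even subgraph are exactly those at which some
two-coloring of the faces changes color. -/
structure PlaneMap (V : Type u) where
  Dart : Type
  fintypeDart : Fintype Dart
  rot : Perm Dart
  rev : Perm Dart
  src : Dart → V
  rev_rev : ∀ d, rev (rev d) = d
  rev_ne : ∀ d, rev d ≠ d
  src_rot : ∀ d, src (rot d) = src d
  sameCycle : ∀ d e, src d = src e → rot.SameCycle d e
  jordan : ∀ C : Dart → ZMod 2, (∀ d, C (rev d) = C d) →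
    (∀ v, ∑ d with src d = v, C d = 0) →
    ∃ c : Dart → ZMod 2, ∀ d, c (rev d) = c d + C d ∧ c (rot d) = c d + C d

attribute [instance] PlaneMap.fintypeDart

theorem Equiv.Perm.SameCycle.induction {D : Type*} [Finite D] {σ : Perm D} {P : D → Prop}
    {x y : D} (h : σ.SameCycle x y) (hx : P x) (step : ∀ a, P a → P (σ a)) : P y := by
  obtain ⟨n, rfl⟩ := h.exists_nat_pow_eq
  clear h
  induction n with
  | zero => simpa
  | succ n ih => rw [pow_succ']; exact step _ ih

namespace PlaneMap

/-- Restriction to a finite set of darts, possibly of an infinite map. -/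
theorem exists_restrict {D : Type} (rot rev : Perm D) (src : D → V) (L : Finset D)
    (rev_rev : ∀ d, rev (rev d) = d) (rev_ne : ∀ d, rev d ≠ d) (rev_mem : ∀ d ∈ L, rev d ∈ L)
    (src_rot : ∀ d, src (rot d) = src d)
    (cyc : ∀ d ∈ L, ∀ e ∈ L, src d = src e → ∃ n, rot^[n + 1] d = e)
    (jordan : ∀ C : D → ZMod 2, (∀ d ∉ L, C d = 0) → (∀ d, C (rev d) = C d) →
      (∀ v, ∑ d ∈ L with src d = v, C d = 0) →
      ∃ c : D → ZMod 2, ∀ d, c (rev d) = c d + C d ∧ c (rot d) = c d + C d) :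
    ∃ (M : PlaneMap V) (ι : M.Dart → D), Function.Injective ι ∧ (∀ d, d ∈ L ↔ ∃ x, ι x = d) ∧
      (∀ x, M.src x = src (ι x)) ∧ ∀ x, ι (M.rev x) = rev (ι x) := by
  have hret : ∀ d : L, ∃ n, rot^[n + 1] d ∈ L := fun d => by
    obtain ⟨n, hn⟩ := cyc d d.2 d d.2 rfl
    exact ⟨n, by rw [hn]; exact d.2⟩
  let ret : L → L := fun d => ⟨rot^[Nat.find (hret d) + 1] d, Nat.find_spec (hret d)⟩
  have hle : ∀ d e : L, ret d = ret e → Nat.find (hret d) ≤ Nat.find (hret e) → d = e := by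
    intro d e h hde
    have h' : rot^[Nat.find (hret d) + 1] (d : D) = rot^[Nat.find (hret e) + 1] (e : D) :=
      congrArg Subtype.val h
    obtain ⟨k, hk⟩ := Nat.exists_eq_add_of_le hde
    have h2 : (d : D) = rot^[k] (e : D) := by
      refine rot.injective.iterate (Nat.find (hret d) + 1) ?_
      rw [h', ← Function.iterate_add_apply, hk, add_right_comm]
    rcases k with _ | k
    · exact Subtype.ext h2
    · exact absurd (show rot^[k + 1] (e : D) ∈ L by rw [← h2]; exact d.2) (Nat.find_min (hret e) (by omega))
  have hinj : Function.Injective ret := fun d e h => by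
    rcases le_total (Nat.find (hret d)) (Nat.find (hret e)) with h1 | h1
    · exact hle d e h h1
    · exact (hle e d h.symm h1).symm
  let rot' : Perm L := Equiv.ofBijective ret (Finite.injective_iff_bijective.1 hinj)
  let rev' : Perm L := ⟨fun d => ⟨rev d, rev_mem d d.2⟩, fun d => ⟨rev d, rev_mem d d.2⟩,
    fun d => Subtype.ext (rev_rev d), fun d => Subtype.ext (rev_rev d)⟩
  have hsrc : ∀ n d, src (rot^[n] d) = src d := fun n d => by
    induction n with
    | zero => rfl
    | succ n ih => rw [Function.iterate_succ_apply', src_rot, ih]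
  have hcyc : ∀ n (d e : L), rot^[n] (d : D) = e → rot'.SameCycle d e := by
    intro n
    induction n using Nat.strong_induction_on with
    | _ n ih =>
      intro d e h
      rcases n with _ | n
      · rw [Subtype.ext (show (d : D) = e from h)]
      · have hn : Nat.find (hret d) ≤ n := Nat.find_min' (hret d) (h ▸ e.2)
        have h2 : rot^[n - Nat.find (hret d)] (ret d : D) = e := by
          rw [← h]
          simp only [ret]
          rw [← Function.iterate_add_apply,
            show n - Nat.find (hret d) + (Nat.find (hret d) + 1) = n + 1 by omega]
        exact Perm.sameCycle_apply_left.1 (ih _ (by omega) (ret d) e h2)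
  refine ⟨⟨L, inferInstance, rot', rev', fun d => src d, fun d => Subtype.ext (rev_rev d),
    fun d h => rev_ne d (congrArg Subtype.val h), fun d => hsrc _ _, fun d e h => ?_,
    fun C hC hs => ?_⟩, Subtype.val, Subtype.val_injective, fun d => by simp, fun _ => rfl,
    fun _ => rfl⟩
  · obtain ⟨n, hn⟩ := cyc d d.2 e e.2 h
    exact hcyc _ d e hn
  · let C' : D → ZMod 2 := fun d => if h : d ∈ L then C ⟨d, h⟩ else 0
    have hC' : ∀ d : L, C' d = C d := fun d => by simp [C']
    obtain ⟨c, hc⟩ := jordan C' (fun d hd => by simp [C', hd]) (fun d => by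
        by_cases h : d ∈ L
        · simp only [C', h, rev_mem d h, dif_pos]
          exact hC ⟨d, h⟩
        · have : rev d ∉ L := fun h' => h (rev_rev d ▸ rev_mem _ h')
          simp [C', h, this]) (fun v => by
        rw [← hs v, sum_filter, sum_filter, ← sum_coe_sort]
        exact sum_congr rfl fun d _ => by rw [hC'])
    refine ⟨fun d => c d, fun d => ⟨by rw [← hC' d]; exact (hc d).1, ?_⟩⟩
    have key : ∀ k ≤ Nat.find (hret d), c (rot^[k + 1] d) = c d + C d := by
      intro k
      induction k with
      | zero => intro _; rw [← hC' d]; exact (hc d).2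
      | succ k ih =>
        intro hk
        rw [Function.iterate_succ_apply', (hc _).2, ih (by omega)]
        have hk' : rot^[k + 1] (d : D) ∉ L := Nat.find_min (hret d) (show k < _ by omega)
        have : C' (rot^[k + 1] d) = 0 := dif_neg hk'
        rw [this, add_zero]
    exact key _ le_rfl

variable (M : PlaneMap V)

theorem face_eq {C c : M.Dart → ZMod 2} (hC : ∀ d, C (M.rev d) = C d)
    (hc : ∀ d, c (M.rev d) = c d + C d ∧ c (M.rot d) = c d + C d) (d : M.Dart) :
    c (M.rot (M.rev d)) = c d := by
  rw [(hc _).2, (hc _).1, hC, add_assoc, CharTwo.add_self_eq_zero, add_zero]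

/-- Relabel vertices by a function that is injective on the vertices in use. -/
noncomputable def relabel {W : Type*} (f : V → W)
    (hf : ∀ d e, f (M.src d) = f (M.src e) → M.src d = M.src e) : PlaneMap W where
  Dart := M.Dart
  fintypeDart := M.fintypeDart
  rot := M.rot
  rev := M.rev
  src d := f (M.src d)
  rev_rev := M.rev_rev
  rev_ne := M.rev_ne
  src_rot d := by rw [M.src_rot]
  sameCycle d e h := M.sameCycle d e (hf d e h)
  jordan C hC hs := M.jordan C hC fun v => by
    by_cases h : ∃ d, M.src d = v
    · obtain ⟨d, rfl⟩ := h
      rw [← hs (f (M.src d))]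
      refine sum_congr (filter_congr fun e _ => ⟨fun h => by rw [h], fun h => hf _ _ h⟩)
        fun _ _ => rfl
    · push Not at h
      exact sum_eq_zero fun d hd => absurd (mem_filter.1 hd).2 (h d)

section Merge

variable {M} {W : Finset M.Dart} {d e : M.Dart}

theorem swap_face_mem_iff (hW : ∀ x ∈ W, swap d e (M.rot (M.rev x)) ∈ W) (x : M.Dart) :
    swap d e (M.rot (M.rev x)) ∈ W ↔ x ∈ W := by
  refine ⟨fun h => ?_, hW x⟩
  let φ : Perm M.Dart := M.rev.trans (M.rot.trans (swap d e))
  have himg : W.image φ = W :=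
    eq_of_subset_of_card_le (fun y hy => by
      obtain ⟨x, hx, rfl⟩ := mem_image.1 hy
      exact hW x hx) (card_image_of_injective _ φ.injective).ge
  have hx : φ x ∈ W.image φ := himg.symm ▸ h
  obtain ⟨y, hy, he⟩ := mem_image.1 hx
  exact φ.injective he ▸ hy

theorem sum_boundary (hd : d ∈ W) (he : e ∉ W)
    (hW : ∀ x ∈ W, swap d e (M.rot (M.rev x)) ∈ W) (v : V) :
    ∑ x with M.src x = v, ((if x ∈ W then (1 : ZMod 2) else 0) + if M.rev x ∈ W then 1 else 0) =
      (if M.src d = v then 1 else 0) + if M.src e = v then 1 else 0 := by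
  have h1 : ∑ x with M.src x = v, (if M.rev x ∈ W then (1 : ZMod 2) else 0) =
      ∑ y ∈ W, if M.src (swap d e y) = v then 1 else 0 := by
    let φ : Perm M.Dart := M.rev.trans (M.rot.trans (swap d e))
    calc _ = ∑ x, if M.rev x ∈ W then (if M.src x = v then (1 : ZMod 2) else 0) else 0 := by
          rw [sum_filter]; exact sum_congr rfl fun x _ => by split_ifs <;> rfl
      _ = ∑ x, if x ∈ W then (if M.src (M.rev x) = v then (1 : ZMod 2) else 0) else 0 := by
          rw [← Equiv.sum_comp M.rev]
          simp only [M.rev_rev]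
      _ = ∑ x, if φ x ∈ W then (if M.src (swap d e (φ x)) = v then (1 : ZMod 2) else 0)
            else 0 := by
          refine sum_congr rfl fun x _ => ?_
          have : swap d e (φ x) = M.rot (M.rev x) := swap_apply_self _ _ _
          rw [this, M.src_rot]
          simp only [φ, Equiv.trans_apply, swap_face_mem_iff hW]
      _ = ∑ y, if y ∈ W then (if M.src (swap d e y) = v then (1 : ZMod 2) else 0) else 0 :=
          Equiv.sum_comp φ fun y => if y ∈ W then
            (if M.src (swap d e y) = v then (1 : ZMod 2) else 0) else 0
      _ = _ := by rw [sum_ite_mem, univ_inter]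
  have h2 : ∑ x with M.src x = v, (if x ∈ W then (1 : ZMod 2) else 0) =
      ∑ y ∈ W, if M.src y = v then 1 else 0 := by
    rw [sum_filter]
    calc _ = ∑ x, if x ∈ W then (if M.src x = v then (1 : ZMod 2) else 0) else 0 :=
          sum_congr rfl fun x _ => by split_ifs <;> rfl
      _ = _ := by rw [sum_ite_mem, univ_inter]
  rw [sum_add_distrib, h1, h2, ← sum_add_distrib, ← add_sum_erase _ _ hd, swap_apply_left,
    sum_eq_zero, add_zero]
  intro y hy
  have hye : y ≠ e := by rintro rfl; exact he (mem_of_mem_erase hy)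
  rw [swap_apply_of_ne_of_ne (ne_of_mem_erase hy) hye, CharTwo.add_self_eq_zero]

/-- Merge the sources of two darts `d`, `e` lying on a common face, splitting that face so that
`W` becomes a union of faces. -/
noncomputable def merge (hd : d ∈ W) (he : e ∉ W)
    (hW : ∀ x ∈ W, swap d e (M.rot (M.rev x)) ∈ W) (hne : M.src d ≠ M.src e)
    (hface : ∀ c : M.Dart → ZMod 2, (∀ x, c (M.rot (M.rev x)) = c x) → c d = c e) :
    PlaneMap V where
  Dart := M.Dart
  fintypeDart := M.fintypeDart
  rot := M.rot.trans (swap d e)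
  rev := M.rev
  src x := if M.src x = M.src e then M.src d else M.src x
  rev_rev := M.rev_rev
  rev_ne := M.rev_ne
  src_rot x := by
    simp only [Equiv.trans_apply]
    by_cases h1 : M.rot x = d
    · have : M.src x = M.src d := by rw [← M.src_rot, h1]
      simp [h1, this]
    · by_cases h2 : M.rot x = e
      · have : M.src x = M.src e := by rw [← M.src_rot, h2]
        simp [h2, this]
      · simp only [swap_apply_of_ne_of_ne h1 h2, M.src_rot]
  sameCycle := by
    set ρ : Perm M.Dart := M.rot.trans (swap d e) with hρ
    have base : ∀ a x, M.src x = M.src a → (a = d ∨ a = e ∨ (M.src a ≠ M.src d ∧ M.src a ≠ M.src e))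
        → ρ.SameCycle a x := by
      intro a x hx ha
      refine ((M.sameCycle a x hx.symm).induction (P := fun y => M.src y = M.src a ∧
        ρ.SameCycle a y) ⟨rfl, .refl _ _⟩ fun y hy => ⟨by rw [M.src_rot, hy.1], ?_⟩).2
      by_cases hya : M.rot y = a
      · rw [hya]
      · have hsy : M.src (M.rot y) = M.src a := by rw [M.src_rot, hy.1]
        have : ρ y = M.rot y := by
          rw [hρ, Equiv.trans_apply]
          apply swap_apply_of_ne_of_ne
          · intro h
            rw [h] at hsy hya
            rcases ha with rfl | rfl | ha
            · exact hya rfl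
            · exact hne hsy
            · exact ha.1 hsy.symm
          · intro h
            rw [h] at hsy hya
            rcases ha with rfl | rfl | ha
            · exact hne hsy.symm
            · exact hya rfl
            · exact ha.2 hsy.symm
        rw [← this]
        exact Perm.sameCycle_apply_right.2 hy.2
    have hde : ρ.SameCycle d e := by
      have h1 : ρ (M.rot.symm d) = e := by simp [hρ]
      rw [← h1]
      refine Perm.sameCycle_apply_right.2 (base d _ ?_ (Or.inl rfl))
      rw [← M.src_rot, Equiv.apply_symm_apply]
    have all : ∀ x, (M.src x = M.src d ∨ M.src x = M.src e) → ρ.SameCycle d x := by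
      rintro x (hx | hx)
      · exact base d x hx (Or.inl rfl)
      · exact hde.trans (base e x hx (Or.inr (Or.inl rfl)))
    intro x y hxy
    by_cases hx : M.src x = M.src d ∨ M.src x = M.src e
    · have hy : M.src y = M.src d ∨ M.src y = M.src e := by
        by_contra hy
        push Not at hy
        rw [if_neg hy.2] at hxy
        split_ifs at hxy
        · exact hy.1 hxy.symm
        · rcases hx with h | h
          · exact hy.1 (hxy ▸ h)
          · exact hy.2 (hxy ▸ h)
      exact (all x hx).symm.trans (all y hy)
    · push Not at hx
      rw [if_neg hx.2] at hxy
      split_ifs at hxy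
      · exact absurd hxy hx.1
      · exact base x y hxy.symm (Or.inr (Or.inr hx))
  jordan C hC hs := by
    set t : ZMod 2 := ∑ x with M.src x = M.src d, C x with ht
    have hte : ∑ x with M.src x = M.src e, C x = t := by
      have h := hs (M.src d)
      have hset : (univ.filter fun x => (if M.src x = M.src e then M.src d else M.src x) = M.src d)
          = univ.filter (fun x => M.src x = M.src d) ∪ univ.filter fun x => M.src x = M.src e := by
        ext x
        simp only [mem_filter, mem_univ, true_and, mem_union]
        split_ifs with h <;> simp [h]
      rw [hset, sum_union, ← ht] at h
      · exact (CharTwo.add_eq_zero.1 h).symm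
      · exact disjoint_filter.2 fun x _ h1 h2 => hne (h1.symm.trans h2)
    let b : M.Dart → ZMod 2 := fun x => if x ∈ W then 1 else 0
    obtain ⟨c, hc⟩ := M.jordan (fun x => C x + t * (b x + b (M.rev x)))
      (fun x => by simp only [M.rev_rev, hC]; ring) (fun v => by
        rw [sum_add_distrib, ← mul_sum, sum_boundary hd he hW]
        by_cases h1 : M.src d = v
        · have h2 : M.src e ≠ v := fun h => hne (h1.trans h.symm)
          subst h1
          simp [h2, ← ht, CharTwo.add_self_eq_zero]
        · by_cases h2 : M.src e = v
          · subst h2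
            simp [h1, hte, CharTwo.add_self_eq_zero]
          · simp only [h1, h2, if_false, add_zero, mul_zero]
            rw [← hs v]
            refine sum_congr (filter_congr fun x _ => ?_) fun _ _ => rfl
            split_ifs with h
            · exact ⟨fun h' => absurd (h.symm.trans h') h2, fun h' => absurd h' h1⟩
            · rfl)
    have hf : ∀ x, c (M.rot (M.rev x)) = c x :=
      M.face_eq (fun x => by simp only [M.rev_rev, hC]; ring) hc
    have hcde := hface c hf
    have hsw : ∀ z, c (swap d e z) = c z := fun z => by
      by_cases h1 : z = d
      · rw [h1, swap_apply_left, hcde]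
      · by_cases h2 : z = e
        · rw [h2, swap_apply_right, hcde]
        · rw [swap_apply_of_ne_of_ne h1 h2]
    have two : ∀ z : ZMod 2, z + z = 0 := CharTwo.add_self_eq_zero
    refine ⟨fun x => c x + t * b x, fun x => ⟨?_, ?_⟩⟩
    · simp only [(hc x).1]
      linear_combination two (t * b (M.rev x))
    · have hb : b (swap d e (M.rot x)) = b (M.rev x) := by
        have := swap_face_mem_iff hW (M.rev x)
        rw [M.rev_rev] at this
        simp only [b, this]
      simp only [Equiv.trans_apply, hb, hsw, (hc x).2]
      linear_combination two (t * b (M.rev x))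

end Merge

/-- Contract the fibers of a vertex labelling that are connected in the map. -/
theorem exists_contract {W : Type*} (f : V → W)
    (hf : ∀ d e, f (M.src d) = f (M.src e) → Relation.ReflTransGen
      (fun a b => ∃ x, M.src x = a ∧ M.src (M.rev x) = b ∧ f a = f b) (M.src d) (M.src e)) :
    ∃ M' : PlaneMap W, ∀ d, ∃ d', M'.src d' = f (M.src d) ∧
      M'.src (M'.rev d') = f (M.src (M.rev d)) := by
  induction hn : #(univ.image M.src) using Nat.strong_induction_on generalizing M with
  | _ n ih =>
  by_cases hinj : ∀ d e, f (M.src d) = f (M.src e) → M.src d = M.src e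
  · exact ⟨M.relabel f hinj, fun d => ⟨d, rfl, rfl⟩⟩
  push Not at hinj
  obtain ⟨d, e, hde, hne⟩ := hinj
  obtain ⟨x, hx, hfx⟩ : ∃ x, M.src x ≠ M.src (M.rev x) ∧ f (M.src x) = f (M.src (M.rev x)) := by
    by_contra! hcon
    have : ∀ a b, Relation.ReflTransGen
        (fun a b => ∃ x, M.src x = a ∧ M.src (M.rev x) = b ∧ f a = f b) a b → a = b := by
      intro a b h
      induction h with
      | refl => rfl
      | tail _ h ih =>
        obtain ⟨x, rfl, rfl, h⟩ := h
        rw [ih]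
        by_contra hne
        exact hcon x hne h
    exact hne (this _ _ (hf d e hde))
  have hse : M.src (M.rot (M.rev x)) = M.src (M.rev x) := M.src_rot _
  let M₁ := M.merge (W := {x}) (d := x) (e := M.rot (M.rev x)) (mem_singleton_self x)
    (by simp only [mem_singleton]; intro h; rw [h] at hse; exact hx hse)
    (by simp) (by rw [hse]; exact hx) (fun c hc => (hc x).symm)
  let r : V → V := fun v => if v = M.src (M.rev x) then M.src x else v
  have hr : ∀ y : M.Dart, M₁.src y = r (M.src y) := fun y => by
    change (if M.src y = M.src (M.rot (M.rev x)) then _ else _) = _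
    rw [hse]
  have hfr : ∀ v, f (r v) = f v := fun v => by
    simp only [r]; split_ifs with h
    · rw [h, hfx]
    · rfl
  have hlt : #(univ.image M₁.src) < n := by
    rw [← hn]
    refine card_lt_card ⟨fun v hv => ?_, fun h => ?_⟩
    · obtain ⟨y, -, rfl⟩ := mem_image.1 hv
      rw [show M₁.src y = r (M.src y) from hr y]
      simp only [r]
      split_ifs
      · exact mem_image_of_mem _ (mem_univ x)
      · exact mem_image_of_mem _ (mem_univ (α := M.Dart) y)
    · obtain ⟨y, -, hy⟩ := mem_image.1 (h (mem_image_of_mem _ (mem_univ (M.rev x))))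
      rw [show M₁.src y = r (M.src y) from hr y] at hy
      simp only [r] at hy
      split_ifs at hy with h'
      · exact hx hy
      · exact h' hy
  obtain ⟨M', hM'⟩ := ih _ hlt M₁ (fun d e h => by
    rw [show M₁.src d = r (M.src d) from hr d, show M₁.src e = r (M.src e) from hr e] at h ⊢
    rw [hfr, hfr] at h
    refine (hf d e h).lift r ?_
    rintro a b ⟨y, rfl, rfl, hy⟩
    exact ⟨y, hr y, hr (M.rev y), by rw [hfr, hfr, hy]⟩) rfl
  refine ⟨M', fun d => ?_⟩
  obtain ⟨d', h1, h2⟩ := hM' d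
  refine ⟨d', ?_, ?_⟩
  · rw [h1, show M₁.src d = r (M.src d) from hr d, hfr]
  · rw [h2, show M₁.src (M₁.rev d) = r (M.src (M.rev d)) from hr (M.rev d), hfr]

end PlaneMap
end PlaneMaps

section Grid

open Finset Equiv

namespace Grid

/-- The unit step in each of the four directions, in counterclockwise order. -/
def step (i : ZMod 4) : ℤ × ℤ :=
  if i = 0 then (1, 0) else if i = 1 then (0, 1) else if i = 2 then (-1, 0) else (0, -1)

theorem step_add_two (i : ZMod 4) : step (i + 2) = -step i := by
  revert i; decide

theorem step_zero : step 0 = (1, 0) := rfl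

theorem step_one : step 1 = (0, 1) := rfl

theorem step_two : step 2 = (-1, 0) := rfl

theorem step_three : step 3 = (0, -1) := rfl

/-- Rotation of the darts of the square grid. -/
def rot : Perm ((ℤ × ℤ) × ZMod 4) where
  toFun d := (d.1, d.2 + 1)
  invFun d := (d.1, d.2 - 1)
  left_inv d := by simp
  right_inv d := by simp

/-- Reversal of the darts of the square grid. -/
def rev : Perm ((ℤ × ℤ) × ZMod 4) where
  toFun d := (d.1 + step d.2, d.2 + 2)
  invFun d := (d.1 + step d.2, d.2 + 2)
  left_inv d := by
    refine Prod.ext ?_ ?_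
    · simp [step_add_two]
    · simp only [add_assoc]; rw [show (2 + 2 : ZMod 4) = 0 by decide, add_zero]
  right_inv d := by
    refine Prod.ext ?_ ?_
    · simp [step_add_two]
    · simp only [add_assoc]; rw [show (2 + 2 : ZMod 4) = 0 by decide, add_zero]

theorem rot_iterate (n : ℕ) (d : (ℤ × ℤ) × ZMod 4) : rot^[n] d = (d.1, d.2 + n) := by
  induction n with
  | zero => simp
  | succ n ih =>
    rw [Function.iterate_succ_apply', ih]
    simp [rot, add_assoc]

theorem jordan (N : ℤ) (C : (ℤ × ℤ) × ZMod 4 → ZMod 2) (hN : ∀ d, d.1.2 ≤ N → C d = 0)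
    (hC : ∀ d, C (rev d) = C d) (hs : ∀ p, ∑ i, C (p, i) = 0) :
    ∃ c : (ℤ × ℤ) × ZMod 4 → ZMod 2, ∀ d, c (rev d) = c d + C d ∧ c (rot d) = c d + C d := by
  let K : ℤ → ℤ → ZMod 2 := fun x y => ∑ t ∈ Ioc N y, C ((x, t), 0)
  have two : ∀ z : ZMod 2, z + z = 0 := CharTwo.add_self_eq_zero
  have c2 : ∀ x y, C ((x, y), 2) = C ((x - 1, y), 0) := fun x y => by
    rw [← hC ((x - 1, y), 0)]; simp [rev, step]
  have c3 : ∀ x y, C ((x, y), 3) = C ((x, y - 1), 1) := fun x y => by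
    have r1 : rev ((x, y - 1), 1) = ((x, y), 3) :=
      Prod.ext (by simp [rev, step_one]) rfl
    rw [← hC ((x, y - 1), 1), r1]
  have hK0 : ∀ x y, K x y = K x (y - 1) + C ((x, y), 0) := fun x y => by
    rcases le_or_gt y N with h | h
    · simp only [K]
      rw [Ioc_eq_empty (by omega), Ioc_eq_empty (by omega), hN _ h]; simp
    · simp only [K]
      rw [show Ioc N y = insert y (Ioc N (y - 1)) by ext; simp; omega, sum_insert (by simp),
        add_comm]
  have hs' : ∀ x y, C ((x, y), 0) + C ((x, y), 1) + C ((x - 1, y), 0) + C ((x, y - 1), 1) = 0 :=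
    fun x y => by
      rw [← c2, ← c3, ← hs (x, y)]
      exact (Fin.sum_univ_four fun i : ZMod 4 => C ((x, y), i)).symm
  have hK1 : ∀ x y, K (x - 1) y + K x y = C ((x, y), 1) := fun x y => by
    rcases le_or_gt y N with h | h
    · simp only [K]
      rw [Ioc_eq_empty (by omega), hN _ h]; simp
    · induction y, (show N ≤ y by omega) using Int.leInduction with
      | base => omega
      | succ y hy ih =>
        have ih' : K (x - 1) y + K x y = C ((x, y), 1) := by
          rcases hy.lt_or_eq with h' | h'
          · exact ih h'
          · simp only [K]
            rw [Ioc_eq_empty (by omega), hN _ h'.ge]; simp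
        have h1 := hs' x (y + 1)
        rw [hK0 x, hK0 (x - 1)]
        simp only [add_sub_cancel_right] at h1 ⊢
        linear_combination ih' + h1 - two (C ((x, y + 1), 1))
  let c : (ℤ × ℤ) × ZMod 4 → ZMod 2 := fun d =>
    if d.2 = 0 then K d.1.1 (d.1.2 - 1) else if d.2 = 1 then K d.1.1 d.1.2
    else if d.2 = 2 then K (d.1.1 - 1) d.1.2 else K (d.1.1 - 1) (d.1.2 - 1)
  have e0 : ∀ x y, c ((x, y), 0) = K x (y - 1) := fun x y => rfl
  have e1 : ∀ x y, c ((x, y), 1) = K x y := fun x y => rfl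
  have e2 : ∀ x y, c ((x, y), 2) = K (x - 1) y := fun x y => rfl
  have e3 : ∀ x y, c ((x, y), 3) = K (x - 1) (y - 1) := fun x y => rfl
  refine ⟨c, fun ⟨⟨x, y⟩, i⟩ => ?_⟩
  have hi : i = 0 ∨ i = 1 ∨ i = 2 ∨ i = 3 := by revert i; decide
  rcases hi with rfl | rfl | rfl | rfl
  · have r1 : rev ((x, y), 0) = ((x + 1, y), 2) := by simp [rev, step]
    have r2 : rot ((x, y), 0) = ((x, y), 1) := rfl
    rw [r1, r2, e0, e1, e2, add_sub_cancel_right]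
    exact ⟨hK0 x y, hK0 x y⟩
  · have r1 : rev ((x, y), 1) = ((x, y + 1), 3) := 
      Prod.ext (by simp [rev, step_one]) rfl
    have r2 : rot ((x, y), 1) = ((x, y), 2) := rfl
    rw [r1, r2, e1, e2, e3, add_sub_cancel_right, ← hK1 x y]
    constructor <;> linear_combination - two (K x y)
  · have r1 : rev ((x, y), 2) = ((x - 1, y), 0) := 
      Prod.ext (by simp [rev, step_two, sub_eq_add_neg]) rfl
    have r2 : rot ((x, y), 2) = ((x, y), 3) := rfl
    rw [r1, r2, e2, e3, e0, c2, hK0 (x - 1) y]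
    constructor <;> linear_combination - two (C ((x - 1, y), 0))
  · have r1 : rev ((x, y), 3) = ((x, y - 1), 1) := 
      Prod.ext (by simp [rev, step_three, sub_eq_add_neg]) rfl
    have r2 : rot ((x, y), 3) = ((x, y), 0) := rfl
    rw [r1, r2, e3, e1, e0, c3, ← hK1 x (y - 1)]
    constructor <;> linear_combination - two (K (x - 1) (y - 1))

/-- The plane map of an induced finite subgraph of the square grid. -/
theorem exists_planeMap (S : Finset (ℤ × ℤ)) : ∃ M : PlaneMap (ℤ × ℤ),
    (∀ d, M.src d ∈ S) ∧ ∀ p ∈ S, ∀ i, p + step i ∈ S →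
      ∃ d, M.src d = p ∧ M.src (M.rev d) = p + step i := by
  classical
  let L : Finset ((ℤ × ℤ) × ZMod 4) := {d ∈ S ×ˢ univ | d.1 + step d.2 ∈ S}
  have hL : ∀ d, d ∈ L ↔ d.1 ∈ S ∧ d.1 + step d.2 ∈ S := fun d => by simp [L]
  obtain ⟨N, hN⟩ : ∃ N, ∀ p ∈ S, N < p.2 := by
    obtain ⟨N, hN⟩ := (S.image Prod.snd).bddBelow
    exact ⟨N - 1, fun p hp => by
      have := hN (mem_coe.2 (mem_image_of_mem Prod.snd hp)); omega⟩
  obtain ⟨M, ι, -, hιL, hsrc, hrev⟩ := PlaneMap.exists_restrict rot rev Prod.fst L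
    rev.left_inv (fun d h => by
      have := congrArg Prod.snd h
      simp only [rev, Equiv.coe_fn_mk, add_eq_left] at this
      exact absurd this (by decide))
    (fun d hd => by
      rw [hL] at hd ⊢
      refine ⟨hd.2, ?_⟩
      simpa [rev, step_add_two] using hd.1)
    (fun _ => rfl)
    (fun d _ e _ h => by
      refine ⟨(e.2 - d.2 - 1 : ZMod 4).val, ?_⟩
      rw [rot_iterate]
      exact Prod.ext h (by simp))
    (fun C h0 hC hs => by
      refine jordan N C (fun d hd => h0 d fun h => ?_) hC fun p => ?_
      · have := hN _ ((hL d).1 h).1; omega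
      · trans ∑ d ∈ L with d.1 = p, C d
        swap
        · convert hs p
        rw [← sum_filter_add_sum_filter_not univ (fun i => (p, i) ∈ L), add_eq_left.2]
        · refine sum_bij (fun i _ => (p, i)) (by simp) (fun i _ j _ h => (Prod.ext_iff.1 h).2)
            (fun d hd => ?_) fun _ _ => rfl
          obtain ⟨h1, rfl⟩ := mem_filter.1 hd
          exact ⟨d.2, by simpa using h1, rfl⟩
        · exact sum_eq_zero fun i hi => h0 _ (mem_filter.1 hi).2)
  refine ⟨M, fun d => ?_, fun p hp i hi => ?_⟩
  · rw [hsrc]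
    exact ((hL _).1 ((hιL _).2 ⟨d, rfl⟩)).1
  · obtain ⟨x, hx⟩ := (hιL (p, i)).1 ((hL _).2 ⟨hp, hi⟩)
    refine ⟨x, ?_, ?_⟩
    · rw [hsrc, hx]
    · rw [hsrc, hrev, hx]; rfl

end Grid
end Grid

section Discretize

open Set Filter Topology Relation

/-- Two grid points of `A` at distance one. -/
def Grid.StepIn (A : Set (ℤ × ℤ)) (p q : ℤ × ℤ) : Prop :=
  p ∈ A ∧ q ∈ A ∧ ∃ i, q = p + Grid.step i

/-- The set `A` is connected in the square grid. -/
def Grid.Conn (A : Set (ℤ × ℤ)) : Prop :=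
  ∀ p ∈ A, ∀ q ∈ A, ReflTransGen (Grid.StepIn A) p q

/-- The graph `G` is a subgraph of the underlying graph of a plane map. -/
def SimpleGraph.MapPlanar (G : SimpleGraph V) : Prop :=
  ∃ M : PlaneMap V, ∀ u v, G.Adj u v → ∃ d, M.src d = u ∧ M.src (M.rev d) = v

theorem Grid.exists_planeMap_of_conn [Finite V] [Nonempty V] (C : V → Set (ℤ × ℤ))
    (E : V → V → Set (ℤ × ℤ)) (finC : ∀ u, (C u).Finite) (finE : ∀ u v, (E u v).Finite)
    (hC : ∀ u, Grid.Conn (C u)) (hE : ∀ u v, Grid.Conn (E u v))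
    (disjC : ∀ u v, u ≠ v → Disjoint (C u) (C v))
    (disjE : ∀ u v u' v', u ≠ u' → Disjoint (E u v) (E u' v'))
    (disjCE : ∀ u v w, w ≠ u → w ≠ v → Disjoint (E u v) (C w)) :
    ∃ M : PlaneMap V, ∀ u v, u ≠ v → (E u v ∩ C u).Nonempty → (E u v ∩ C v).Nonempty →
      ∃ d, M.src d = u ∧ M.src (M.rev d) = v := by
  classical
  let R : V → V → Set (ℤ × ℤ) := fun u v =>
    {p | ∃ q ∈ E u v ∩ C u, ReflTransGen (Grid.StepIn (E u v \ C v)) q p}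
  have hR : ∀ u v p, p ∈ R u v → p ∈ C u ∨ p ∈ E u v \ C v := by
    rintro u v p ⟨q, hq, h⟩
    rcases h.cases_tail with rfl | ⟨a, -, h⟩
    · exact Or.inl hq.2
    · exact Or.inr h.2.1
  let B : V → Set (ℤ × ℤ) := fun u => C u ∪ ⋃ v, R u v
  have hB : ∀ u p, p ∈ B u → p ∈ C u ∨ ∃ v, p ∈ E u v \ C v := by
    rintro u p (h | h)
    · exact Or.inl h
    · obtain ⟨v, h⟩ := mem_iUnion.1 h
      exact (hR u v p h).imp id fun h => ⟨v, h⟩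
  have disjCB : ∀ u w p, w ≠ u → p ∈ C w → p ∉ B u := by
    intro u w p hne hp h
    rcases hB u p h with h | ⟨v, h, h'⟩
    · exact disjoint_left.1 (disjC w u hne) hp h
    · by_cases hv : w = v
      · exact h' (hv ▸ hp)
      · exact disjoint_left.1 (disjCE u v w hne hv) h hp
  have disjB : ∀ u w p, p ∈ B u → p ∈ B w → u = w := by
    intro u w p hu hw
    by_contra hne
    rcases hB u p hu with h | ⟨v, h⟩
    · exact disjCB w u p hne h hw
    · rcases hB w p hw with h' | ⟨v', h'⟩
      · exact disjCB u w p (Ne.symm hne) h' hu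
      · exact disjoint_left.1 (disjE u v w v' hne) h.1 h'.1
  have hfin : {p | ∃ u, p ∈ B u}.Finite := by
    refine ((finite_iUnion finC).union (finite_iUnion fun u => finite_iUnion (finE u))).subset ?_
    rintro p ⟨u, hu⟩
    rcases hB u p hu with h | ⟨v, h⟩
    · exact Or.inl (mem_iUnion.2 ⟨u, h⟩)
    · exact Or.inr (mem_iUnion.2 ⟨u, mem_iUnion.2 ⟨v, h.1⟩⟩)
  let f : ℤ × ℤ → V := fun p => if h : ∃ u, p ∈ B u then h.choose else Classical.arbitrary V
  have hf : ∀ u p, p ∈ B u → f p = u := fun u p h => by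
    have hex : ∃ u, p ∈ B u := ⟨u, h⟩
    simp only [f, dif_pos hex]
    exact disjB _ _ p hex.choose_spec h
  obtain ⟨M, hMS, hM⟩ := Grid.exists_planeMap hfin.toFinset
  let r : ℤ × ℤ → ℤ × ℤ → Prop := fun a b => ∃ x, M.src x = a ∧ M.src (M.rev x) = b ∧ f a = f b
  have hrB : ∀ u a b i, a ∈ B u → b ∈ B u → b = a + Grid.step i → r a b := by
    rintro u a b i ha hb rfl
    obtain ⟨d, h1, h2⟩ := hM a (hfin.mem_toFinset.2 ⟨u, ha⟩) i (hfin.mem_toFinset.2 ⟨u, hb⟩)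
    exact ⟨d, h1, h2, by rw [hf u _ ha, hf u _ hb]⟩
  have hr : Std.Symm r := ⟨fun a b ⟨x, h1, h2, h3⟩ =>
    ⟨M.rev x, h2, by rw [M.rev_rev, h1], h3.symm⟩⟩
  have hsymm : ∀ {a b}, ReflTransGen r a b → ReflTransGen r b a := fun h =>
    (ReflTransGen.stdSymm (r := r)).symm _ _ h
  have hconnC : ∀ u, ∀ p ∈ C u, ∀ q ∈ C u, ReflTransGen r p q := fun u p hp q hq =>
    ReflTransGen.lift id (fun a b ⟨ha, hb, i, h⟩ => hrB u a b i (Or.inl ha) (Or.inl hb) h) _ _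
      (hC u p hp q hq)
  have hconnB : ∀ u, ∀ p ∈ B u, ∃ q ∈ C u, ReflTransGen r q p := by
    rintro u p (h | hp)
    · exact ⟨p, h, .refl⟩
    · obtain ⟨v, q, hq, h⟩ := mem_iUnion.1 hp
      clear hp
      refine ⟨q, hq.2, ?_⟩
      induction h with
      | refl => exact .refl
      | tail h1 h2 ih =>
        obtain ⟨i, hi⟩ := h2.2.2
        exact ih.tail (hrB u _ _ i (Or.inr (mem_iUnion.2 ⟨v, q, hq, h1⟩))
          (Or.inr (mem_iUnion.2 ⟨v, q, hq, h1.tail h2⟩)) hi)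
  obtain ⟨M', hM'⟩ := M.exists_contract f fun d e h => by
    obtain ⟨u, hu⟩ := hfin.mem_toFinset.1 (hMS d)
    obtain ⟨w, hw⟩ := hfin.mem_toFinset.1 (hMS e)
    rw [hf u _ hu, hf w _ hw] at h
    subst h
    obtain ⟨p, hp, h1⟩ := hconnB u _ hu
    obtain ⟨q, hq, h2⟩ := hconnB u _ hw
    exact ((hsymm h1).trans (hconnC u p hp q hq)).trans h2
  refine ⟨M', fun u v hne ⟨q, hq⟩ ⟨z, hz⟩ => ?_⟩
  have key : ∀ x, ReflTransGen (Grid.StepIn (E u v)) q x →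
      x ∈ R u v ∨ ∃ a ∈ B u, ∃ b ∈ B v, ∃ i, b = a + Grid.step i := by
    intro x hx
    induction hx with
    | refl => exact Or.inl ⟨q, hq, .refl⟩
    | @tail a b h1 h2 ih =>
      rcases ih with ih | ih
      · obtain ⟨i, hi⟩ := h2.2.2
        by_cases hb : b ∈ C v
        · exact Or.inr ⟨a, Or.inr (mem_iUnion.2 ⟨v, ih⟩), b, Or.inl hb, i, hi⟩
        · have ha : a ∉ C v := by
            rcases hR u v a ih with h | h
            · exact disjoint_left.1 (disjC u v hne) h
            · exact h.2
          obtain ⟨q', hq', h⟩ := ih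
          exact Or.inl ⟨q', hq', h.tail ⟨⟨h2.1, ha⟩, ⟨h2.2.1, hb⟩, i, hi⟩⟩
      · exact Or.inr ih
  rcases key z (hE u v q hq.1 z hz.1) with h | ⟨a, ha, b, hb, i, rfl⟩
  · rcases hR u v z h with h | h
    · exact absurd hz.2 (disjoint_left.1 (disjC u v hne) h)
    · exact absurd hz.2 h.2
  · obtain ⟨d, h1, h2⟩ := hM a (hfin.mem_toFinset.2 ⟨u, ha⟩) i (hfin.mem_toFinset.2 ⟨v, hb⟩)
    obtain ⟨d', h3, h4⟩ := hM' d
    exact ⟨d', by rw [h3, h1, hf u _ ha], by rw [h4, h2, hf v _ hb]⟩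

/-- The closed grid square of side `η` with lower left corner `η • p`. -/
def Grid.square (η : ℝ) (p : ℤ × ℤ) : Set (ℝ × ℝ) :=
  Icc (p.1 * η) ((p.1 + 1) * η) ×ˢ Icc (p.2 * η) ((p.2 + 1) * η)

/-- The grid squares of side `η` meeting `K`. -/
def Grid.cells (η : ℝ) (K : Set (ℝ × ℝ)) : Set (ℤ × ℤ) :=
  {p | (K ∩ Grid.square η p).Nonempty}

namespace Grid

variable {η : ℝ} {K L : Set (ℝ × ℝ)}

theorem exists_mem_square (hη : 0 < η) (x : ℝ × ℝ) : ∃ p, x ∈ square η p := by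
  refine ⟨(⌊x.1 / η⌋, ⌊x.2 / η⌋), ⟨?_, ?_⟩, ?_, ?_⟩
  · exact (le_div_iff₀ hη).1 (Int.floor_le _)
  · exact (div_le_iff₀ hη).1 (Int.lt_floor_add_one _).le
  · exact (le_div_iff₀ hη).1 (Int.floor_le _)
  · exact (div_le_iff₀ hη).1 (Int.lt_floor_add_one _).le

theorem finite_cells (hη : 0 < η) (hK : IsCompact K) : (cells η K).Finite := by
  obtain ⟨R, hR⟩ := hK.isBounded.exists_norm_le
  refine (finite_Icc ((⌊-R / η - 1⌋, ⌊-R / η - 1⌋) : ℤ × ℤ) (⌈R / η⌉, ⌈R / η⌉)).subset ?_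
  rintro p ⟨x, hx, h1, h2⟩
  have h3 := (norm_prod_le_iff.1 (hR x hx))
  rw [Real.norm_eq_abs, Real.norm_eq_abs, abs_le, abs_le] at h3
  have lo : ∀ (i : ℤ) (t : ℝ), -R ≤ t → t ≤ (i + 1) * η → ⌊-R / η - 1⌋ ≤ i := fun i t h h' => by
    have : -R / η - 1 ≤ i := by
      rw [sub_le_iff_le_add, div_le_iff₀ hη]; linarith
    exact_mod_cast (Int.floor_le _).trans this
  have hi : ∀ (i : ℤ) (t : ℝ), t ≤ R → i * η ≤ t → i ≤ ⌈R / η⌉ := fun i t h h' => by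
    have : (i : ℝ) ≤ R / η := by
      rw [le_div_iff₀ hη]; linarith
    exact_mod_cast this.trans (Int.le_ceil _)
  exact ⟨⟨lo _ _ h3.1.1 h1.2, lo _ _ h3.2.1 h2.2⟩, hi _ _ h3.1.2 h1.1, hi _ _ h3.2.2 h2.1⟩

theorem exists_step_of_abs_le {A : Set (ℤ × ℤ)} {p q : ℤ × ℤ} (hp : p ∈ A) (hq : q ∈ A)
    (h : |p.1 - q.1| + |p.2 - q.2| ≤ 1) : ReflTransGen (StepIn A) p q := by
  by_cases hpq : p = q
  · rw [hpq]
  · refine .single ⟨hp, hq, ?_⟩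
    obtain ⟨a, b⟩ := p
    obtain ⟨c, d⟩ := q
    simp only [Prod.mk.injEq] at h hpq
    have : (c = a + 1 ∧ d = b) ∨ (c = a ∧ d = b + 1) ∨ (c = a - 1 ∧ d = b) ∨ (c = a ∧ d = b - 1) := by
      rcases abs_cases (a - c) with h1 | h1 <;> rcases abs_cases (b - d) with h2 | h2 <;> omega
    rcases this with ⟨rfl, rfl⟩ | ⟨rfl, rfl⟩ | ⟨rfl, rfl⟩ | ⟨rfl, rfl⟩
    · exact ⟨0, by simp [step_zero]⟩
    · exact ⟨1, by simp [step_one]⟩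
    · exact ⟨2, by simp [step_two, sub_eq_add_neg]⟩
    · exact ⟨3, by simp [step_three, sub_eq_add_neg]⟩

theorem abs_sub_le_one (hη : 0 < η) {i j : ℤ} {t : ℝ} (hi : t ∈ Icc (i * η) ((i + 1) * η))
    (hj : t ∈ Icc (j * η) ((j + 1) * η)) : |i - j| ≤ 1 := by
  have h1 : (i : ℝ) ≤ j + 1 := le_of_mul_le_mul_right (hi.1.trans hj.2) hη
  have h2 : (j : ℝ) ≤ i + 1 := le_of_mul_le_mul_right (hj.1.trans hi.2) hη
  have h3 : i ≤ j + 1 := by exact_mod_cast h1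
  have h4 : j ≤ i + 1 := by exact_mod_cast h2
  rw [abs_le]; omega

theorem conn_cells (hη : 0 < η) (hK : IsCompact K) (hc : IsPreconnected K) :
    Conn (cells η K) := by
  intro p hp q hq
  by_contra hpq
  let A := {a ∈ cells η K | ReflTransGen (StepIn (cells η K)) p a}
  let B := {a ∈ cells η K | ¬ ReflTransGen (StepIn (cells η K)) p a}
  have hcl : ∀ T ⊆ cells η K, IsClosed (⋃ a ∈ T, square η a) := fun T hT =>
    ((finite_cells hη hK).subset hT).isClosed_biUnion fun a _ => isClosed_Icc.prod isClosed_Icc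
  have hAB := isPreconnected_closed_iff.1 hc _ _ (hcl A fun _ h => h.1) (hcl B fun _ h => h.1)
    (fun x hx => by
      obtain ⟨a, ha⟩ := exists_mem_square hη x
      by_cases h : ReflTransGen (StepIn (cells η K)) p a
      · exact Or.inl (mem_biUnion (show a ∈ A from ⟨⟨x, hx, ha⟩, h⟩) ha)
      · exact Or.inr (mem_biUnion (show a ∈ B from ⟨⟨x, hx, ha⟩, h⟩) ha))
    (by
      obtain ⟨x, hx, h⟩ := hp
      exact ⟨x, hx, mem_biUnion (show p ∈ A from ⟨⟨x, hx, h⟩, .refl⟩) h⟩)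
    (by
      obtain ⟨x, hx, h⟩ := hq
      exact ⟨x, hx, mem_biUnion (show q ∈ B from ⟨⟨x, hx, h⟩, hpq⟩) h⟩)
  obtain ⟨x, hx, hxA, hxB⟩ := hAB
  obtain ⟨a, ⟨ha, hpa⟩, hxa⟩ := mem_iUnion₂.1 hxA
  obtain ⟨b, ⟨hb, hpb⟩, hxb⟩ := mem_iUnion₂.1 hxB
  have hm : (a.1, b.2) ∈ cells η K := ⟨x, hx, hxa.1, hxb.2⟩
  refine hpb ((hpa.trans (exists_step_of_abs_le ha hm ?_)).trans (exists_step_of_abs_le hm hb ?_))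
  · simpa using abs_sub_le_one hη hxa.2 hxb.2
  · simpa using abs_sub_le_one hη hxa.1 hxb.1

theorem eventually_disjoint_cells (hK : IsCompact K) (hL : IsCompact L) :
    ∀ᶠ η in 𝓝[>] (0 : ℝ), Disjoint K L → Disjoint (cells η K) (cells η L) := by
  by_cases hKL : Disjoint K L
  · obtain ⟨δ, hδ, h⟩ := hKL.exists_thickenings hK hL.isClosed
    filter_upwards [Ioo_mem_nhdsGT hδ] with η hη _
    refine disjoint_left.2 fun p ⟨x, hx, hxp⟩ ⟨y, hy, hyp⟩ => ?_
    refine disjoint_left.1 h (Metric.self_subset_thickening hδ _ hx)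
      (Metric.mem_thickening_iff.2 ⟨y, hy, lt_of_le_of_lt ?_ hη.2⟩)
    rw [Prod.dist_eq, max_le_iff, Real.dist_eq, Real.dist_eq, abs_le, abs_le]
    have := hxp.1.1; have := hxp.1.2; have := hxp.2.1; have := hxp.2.2
    have := hyp.1.1; have := hyp.1.2; have := hyp.2.1; have := hyp.2.2
    refine ⟨⟨?_, ?_⟩, ?_, ?_⟩ <;> linarith
  · exact Eventually.of_forall fun _ h => absurd h hKL

theorem cells_mono_inter {x : ℝ × ℝ} (hη : 0 < η) (hK : x ∈ K) (hL : x ∈ L) :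
    (cells η K ∩ cells η L).Nonempty := by
  obtain ⟨p, hp⟩ := exists_mem_square hη x
  exact ⟨p, ⟨x, hK, hp⟩, x, hL, hp⟩

end Grid

/-- The arcs of a drawing may be chosen independently of the orientation of the edges. -/
theorem GraphEmbeddingIn.exists_symm {X : Type*} [TopologicalSpace X] [Countable V]
    {G : SimpleGraph V} (Γ : GraphEmbeddingIn X G) : ∃ α : V → V → ℝ → X,
    (∀ u v, ContinuousOn (α u v) (Icc 0 1)) ∧ (∀ u v, α u v 0 = Γ.vertexPos u) ∧
    (∀ u v, ¬ G.Adj u v → ∀ t, α u v t = Γ.vertexPos u) ∧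
    (∀ u v, G.Adj u v → ∀ t, α u v t = α v u (1 - t)) ∧
    (∀ u v, G.Adj u v → InjOn (α u v) (Icc 0 1)) ∧
    (∀ u v, G.Adj u v → ∀ t ∈ Ioo (0 : ℝ) 1, ∀ w, α u v t ≠ Γ.vertexPos w) ∧
    ∀ u v u' v', G.Adj u v → G.Adj u' v' → s(u, v) ≠ s(u', v') → ∀ t ∈ Ioo (0 : ℝ) 1,
      ∀ t' ∈ Icc (0 : ℝ) 1, α u v t ≠ α u' v' t' := by
  classical
  obtain ⟨ix, hix⟩ := exists_injective_nat V
  let α : V → V → ℝ → X := fun u v t => if h : G.Adj u v then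
    if ix u < ix v then Γ.edgeArc u v h t else Γ.edgeArc v u h.symm (1 - t) else Γ.vertexPos u
  have h1 : ∀ u v (h : G.Adj u v), ix u < ix v → α u v = Γ.edgeArc u v h := fun u v h h' => by
    funext t; simp [α, h, h']
  have h2 : ∀ u v (h : G.Adj u v), ¬ ix u < ix v → α u v = fun t => Γ.edgeArc v u h.symm (1 - t) :=
    fun u v h h' => by funext t; simp [α, h, h']
  have h3 : ∀ u v, ¬ G.Adj u v → α u v = fun _ => Γ.vertexPos u := fun u v h => by
    funext t; simp [α, h]
  have key : ∀ u v, G.Adj u v → ∃ u' v', ∃ h : G.Adj u' v', s(u, v) = s(u', v') ∧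
      (∀ t ∈ Icc (0 : ℝ) 1, ∃ t' ∈ Icc (0 : ℝ) 1, α u v t = Γ.edgeArc u' v' h t') ∧
      ∀ t ∈ Ioo (0 : ℝ) 1, ∃ t' ∈ Ioo (0 : ℝ) 1, α u v t = Γ.edgeArc u' v' h t' := by
    intro u v h
    by_cases h' : ix u < ix v
    · exact ⟨u, v, h, rfl, fun t ht => ⟨t, ht, by rw [h1 u v h h']⟩,
        fun t ht => ⟨t, ht, by rw [h1 u v h h']⟩⟩
    · refine ⟨v, u, h.symm, Sym2.eq_swap, fun t ht => ⟨1 - t, ?_, by rw [h2 u v h h']⟩,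
        fun t ht => ⟨1 - t, ?_, by rw [h2 u v h h']⟩⟩
      · exact ⟨by linarith [ht.2], by linarith [ht.1]⟩
      · exact ⟨by linarith [ht.2], by linarith [ht.1]⟩
  refine ⟨α, fun u v => ?_, fun u v => ?_, fun u v h t => by rw [h3 u v h], fun u v h t => ?_,
    fun u v h => ?_, fun u v h t ht w hw => ?_, fun u v u' v' h h' hne t ht t' ht' he => ?_⟩
  · by_cases h : G.Adj u v
    · by_cases h' : ix u < ix v
      · rw [h1 u v h h']; exact Γ.arc_cont u v h
      · rw [h2 u v h h']
        refine (Γ.arc_cont v u h.symm).comp (by fun_prop) fun t ht => ?_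
        exact ⟨by linarith [ht.2], by linarith [ht.1]⟩
    · rw [h3 u v h]; exact continuousOn_const
  · by_cases h : G.Adj u v
    · by_cases h' : ix u < ix v
      · rw [h1 u v h h', Γ.arc_start]
      · simp only [h2 u v h h', sub_zero, Γ.arc_end]
    · rw [h3 u v h]
  · by_cases h' : ix u < ix v
    · simp only [h1 u v h h', h2 v u h.symm (by omega), sub_sub_cancel]
    · have : ix u ≠ ix v := fun h' => h.ne (hix h')
      rw [h2 u v h h', h1 v u h.symm (by omega)]
  · by_cases h' : ix u < ix v
    · rw [h1 u v h h']; exact Γ.arc_injOn u v h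
    · rw [h2 u v h h']
      intro t ht t' ht' he
      have := Γ.arc_injOn v u h.symm (show 1 - t ∈ Icc (0 : ℝ) 1 from
        ⟨by linarith [ht.2], by linarith [ht.1]⟩) (show 1 - t' ∈ Icc (0 : ℝ) 1 from
        ⟨by linarith [ht'.2], by linarith [ht'.1]⟩) he
      linarith
  · obtain ⟨a, b, hab, -, -, h4⟩ := key u v h
    obtain ⟨s, hs, h5⟩ := h4 t ht
    exact Γ.arc_avoid a b hab w ⟨s, hs, h5.symm.trans hw⟩
  · obtain ⟨a, b, hab, e1, -, h4⟩ := key u v h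
    obtain ⟨a', b', hab', e2, h4', -⟩ := key u' v' h'
    obtain ⟨s, hs, h5⟩ := h4 t ht
    obtain ⟨s', hs', h5'⟩ := h4' t' ht'
    have := Γ.arc_disjoint a b hab a' b' hab' (by rwa [← e1, ← e2])
    exact this.subset ⟨⟨s, hs, h5.symm⟩, s', hs', h5'.symm.trans he.symm⟩

theorem SimpleGraph.IsPlanar.mapPlanar [Finite V] {G : SimpleGraph V} (hG : G.IsPlanar) :
    G.MapPlanar := by
  rcases isEmpty_or_nonempty V with hV | hV
  · exact ⟨⟨Empty, inferInstance, 1, 1, Empty.elim, fun d => d.elim, fun d => d.elim,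
      fun d => d.elim, fun d => d.elim, fun _ _ _ => ⟨0, fun d => d.elim⟩⟩, fun u => hV.elim u⟩
  obtain ⟨Γ⟩ := hG
  obtain ⟨α, cont, zero, const, symm, inj, avoid, disj⟩ := Γ.exists_symm
  obtain ⟨ix, hix⟩ := exists_injective_nat V
  let K : V ⊕ V × V → Set (ℝ × ℝ) := Sum.elim (fun u => ⋃ v, α u v '' Icc 0 (1 / 3))
    fun e => {x | G.Adj e.1 e.2 ∧ ix e.1 < ix e.2 ∧ x ∈ α e.1 e.2 '' Icc (1 / 3) (2 / 3)}
  have sub1 : Icc (0 : ℝ) (1 / 3) ⊆ Icc 0 1 := Icc_subset_Icc le_rfl (by norm_num)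
  have sub2 : Icc (1 / 3 : ℝ) (2 / 3) ⊆ Ioo 0 1 := fun t ht =>
    ⟨by linarith [ht.1], by linarith [ht.2]⟩
  have hinr : ∀ e, K (.inr e) = α e.1 e.2 '' Icc (1 / 3) (2 / 3) ∨ K (.inr e) = ∅ := fun e => by
    by_cases h : G.Adj e.1 e.2 ∧ ix e.1 < ix e.2
    · left; ext x; simp [K, h]
    · right; ext x; simp only [K, Sum.elim_inr, mem_ofPred_eq, mem_empty_iff_false]; tauto
  have cpt : ∀ i, IsCompact (K i) := by
    rintro (u | e)
    · exact isCompact_iUnion fun v => isCompact_Icc.image_of_continuousOn ((cont u v).mono sub1)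
    · rcases hinr e with h | h <;> rw [h]
      · exact isCompact_Icc.image_of_continuousOn
          ((cont _ _).mono (sub2.trans Ioo_subset_Icc_self))
      · exact isCompact_empty
  have conn : ∀ i, IsPreconnected (K i) := by
    rintro (u | e)
    · exact isPreconnected_iUnion
        ⟨Γ.vertexPos u, mem_iInter.2 fun v => ⟨0, ⟨le_rfl, by norm_num⟩, zero u v⟩⟩
        fun v => isPreconnected_Icc.image _ ((cont u v).mono sub1)
    · rcases hinr e with h | h <;> rw [h]
      · exact isPreconnected_Icc.image _ ((cont _ _).mono (sub2.trans Ioo_subset_Icc_self))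
      · exact isPreconnected_empty
  have hstar : ∀ u x, x ∈ K (.inl u) → x = Γ.vertexPos u ∨ ∃ v, G.Adj u v ∧
      ∃ t ∈ Ioc (0 : ℝ) (1 / 3), α u v t = x := by
    intro u x hx
    obtain ⟨v, t, ht, rfl⟩ := mem_iUnion.1 hx
    by_cases h : G.Adj u v
    · rcases ht.1.eq_or_lt with h0 | h0
      · left; rw [← h0, zero]
      · exact Or.inr ⟨v, h, t, ⟨h0, ht.2⟩, rfl⟩
    · exact Or.inl (const u v h t)
  have dC : ∀ u v, u ≠ v → Disjoint (K (.inl u)) (K (.inl v)) := by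
    intro u v hne
    rw [Set.disjoint_left]
    intro x hu hv
    rcases hstar u x hu with rfl | ⟨a, ha, t, ht, rfl⟩
    · rcases hstar v _ hv with h | ⟨b, hb, s, hs, h⟩
      · exact hne (Γ.vertexInj h)
      · exact avoid v b hb s ⟨hs.1, by linarith [hs.2]⟩ u h
    · have ht' : t ∈ Ioo (0 : ℝ) 1 := ⟨ht.1, by linarith [ht.2]⟩
      rcases hstar v _ hv with h | ⟨b, hb, s, hs, h⟩
      · exact avoid u a ha t ht' v h
      · by_cases he : s(u, a) = s(v, b)
        · rcases Sym2.eq_iff.1 he with ⟨rfl, -⟩ | ⟨rfl, rfl⟩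
          · exact hne rfl
          · rw [symm _ _ hb] at h
            have := inj _ _ ha ⟨by linarith [hs.2], by linarith [hs.1]⟩ (Ioo_subset_Icc_self ht') h
            linarith [ht.2, hs.2]
        · exact disj u a v b ha hb he t ht' s ⟨hs.1.le, by linarith [hs.2]⟩ h.symm
  have dE : ∀ u v u' v', u ≠ u' → Disjoint (K (.inr (u, v))) (K (.inr (u', v'))) := by
    intro u v u' v' hne
    rw [Set.disjoint_left]
    rintro x ⟨h1, h2, t, ht, rfl⟩ ⟨h3, h4, s, hs, h⟩
    refine disj u v u' v' h1 h3 (fun he => ?_) t (sub2 ht) s (Ioo_subset_Icc_self (sub2 hs)) h.symm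
    rcases Sym2.eq_iff.1 he with ⟨rfl, -⟩ | ⟨rfl, rfl⟩
    · exact hne rfl
    · exact lt_asymm h2 h4
  have dCE : ∀ u v w, w ≠ u → w ≠ v → Disjoint (K (.inr (u, v))) (K (.inl w)) := by
    intro u v w hu hv
    rw [Set.disjoint_left]
    rintro x ⟨h1, h2, t, ht, rfl⟩ hx
    rcases hstar w _ hx with h | ⟨b, hb, s, hs, h⟩
    · exact avoid u v h1 t (sub2 ht) w h
    · refine disj u v w b h1 hb (fun he => ?_) t (sub2 ht) s ⟨hs.1.le, by linarith [hs.2]⟩ h.symm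
      rcases Sym2.eq_iff.1 he with ⟨rfl, -⟩ | ⟨-, rfl⟩
      · exact hu rfl
      · exact hv rfl
  obtain ⟨η, hη, hdisj⟩ : ∃ η > (0 : ℝ), ∀ i j, Disjoint (K i) (K j) →
      Disjoint (Grid.cells η (K i)) (Grid.cells η (K j)) := by
    have h : ∀ᶠ η in 𝓝[>] (0 : ℝ), ∀ i j, Disjoint (K i) (K j) →
        Disjoint (Grid.cells η (K i)) (Grid.cells η (K j)) :=
      eventually_all.2 fun i => eventually_all.2 fun j =>
        Grid.eventually_disjoint_cells (cpt i) (cpt j)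
    obtain ⟨η, h, hη⟩ := (h.and self_mem_nhdsWithin).exists
    exact ⟨η, hη, h⟩
  obtain ⟨M, hM⟩ := Grid.exists_planeMap_of_conn (fun u => Grid.cells η (K (.inl u)))
    (fun u v => Grid.cells η (K (.inr (u, v)))) (fun u => Grid.finite_cells hη (cpt _))
    (fun u v => Grid.finite_cells hη (cpt _)) (fun u => Grid.conn_cells hη (cpt _) (conn _))
    (fun u v => Grid.conn_cells hη (cpt _) (conn _)) (fun u v h => hdisj _ _ (dC u v h))
    (fun u v u' v' h => hdisj _ _ (dE u v u' v' h))
    (fun u v w h h' => hdisj _ _ (dCE u v w h h'))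
  have hlt : ∀ u v, G.Adj u v → ix u < ix v → ∃ d, M.src d = u ∧ M.src (M.rev d) = v := by
    intro u v h h'
    refine hM u v h.ne (Grid.cells_mono_inter (x := α u v (1 / 3)) hη
      ⟨h, h', 1 / 3, by norm_num, rfl⟩ (mem_iUnion.2 ⟨v, 1 / 3, by norm_num, rfl⟩))
      (Grid.cells_mono_inter (x := α u v (2 / 3)) hη ⟨h, h', 2 / 3, by norm_num, rfl⟩
      (mem_iUnion.2 ⟨u, 1 / 3, by norm_num, ?_⟩))
    rw [symm u v h]; norm_num
  refine ⟨M, fun u v h => ?_⟩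
  rcases lt_trichotomy (ix u) (ix v) with h' | h' | h'
  · exact hlt u v h h'
  · exact absurd (hix h') h.ne
  · obtain ⟨d, h1, h2⟩ := hlt v u h.symm h'
    exact ⟨M.rev d, h2, by rw [M.rev_rev, h1]⟩

end Discretize

section Faces

open Finset Equiv
open scoped Classical

namespace PlaneMap

/-- The underlying graph of `M` is the simple graph `G`. -/
structure Exact (M : PlaneMap V) (G : SimpleGraph V) : Prop where
  inj : ∀ d e, M.src d = M.src e → M.src (M.rev d) = M.src (M.rev e) → d = e
  adj_iff : ∀ u v, G.Adj u v ↔ ∃ d, M.src d = u ∧ M.src (M.rev d) = v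

variable (M : PlaneMap V)

/-- The successor of a dart along its face. -/
noncomputable def next : Perm M.Dart := M.rev.trans M.rot

theorem next_apply (d : M.Dart) : M.next d = M.rot (M.rev d) := rfl

theorem src_next (d : M.Dart) : M.src (M.next d) = M.src (M.rev d) := M.src_rot _

/-- The inequality between the numbers of edges, faces and vertices given by Euler's formula. -/
theorem card_edges_add_two_le [Nonempty M.Dart] :
    Fintype.card (Quotient (Perm.SameCycle.setoid M.rev)) + 2 ≤
      Fintype.card (Quotient (Perm.SameCycle.setoid M.next)) + #(univ.image M.src) := by
  let Qα := Quotient (Perm.SameCycle.setoid M.rev)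
  let Qφ := Quotient (Perm.SameCycle.setoid M.next)
  let mkα : M.Dart → Qα := Quotient.mk _
  let mkφ : M.Dart → Qφ := Quotient.mk _
  have two : ∀ z : (ZMod 2), z + z = 0 := CharTwo.add_self_eq_zero
  have hα : ∀ d, mkα (M.rev d) = mkα d := fun d => Quotient.sound
    (Perm.sameCycle_apply_left.2 (Perm.SameCycle.refl _ _))
  let bd : (Qα → (ZMod 2)) →ₗ[(ZMod 2)] ((univ.image M.src) → (ZMod 2)) :=
    { toFun := fun g v => ∑ d with M.src d = v, g (mkα d)
      map_add' := fun g g' => by funext v; simp [sum_add_distrib]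
      map_smul' := fun a g => by funext v; exact (mul_sum _ _ _).symm }
  let sm : ((univ.image M.src) → (ZMod 2)) →ₗ[(ZMod 2)] (ZMod 2) := ∑ v, LinearMap.proj v
  have hsm : ∀ g, sm g = ∑ v, g v := fun g => by simp [sm]
  have hrange : LinearMap.range bd ≤ LinearMap.ker sm := by
    rintro _ ⟨g, rfl⟩
    rw [LinearMap.mem_ker, hsm]
    change ∑ v : (univ.image M.src), ∑ d with M.src d = v, g (mkα d) = 0
    rw [sum_coe_sort (univ.image M.src)
      (fun v => ∑ d with M.src d = v, g (mkα d)),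
      sum_fiberwise_of_maps_to (g := M.src) (fun d _ => mem_image_of_mem _ (mem_univ d))]
    refine sum_involution (fun d _ => M.rev d) (fun d _ => ?_) (fun d _ _ => M.rev_ne d)
      (fun d _ => mem_univ _) (fun d _ => M.rev_rev d)
    rw [hα, two]
  have hsurj : Function.Surjective sm := by
    intro a
    obtain ⟨d⟩ := ‹Nonempty M.Dart›
    refine ⟨Pi.single ⟨M.src d, mem_image_of_mem _ (mem_univ d)⟩ a, ?_⟩
    rw [hsm]; simp
  have h1 := LinearMap.finrank_range_add_finrank_ker sm
  rw [LinearMap.range_eq_top.2 hsurj, finrank_top, Module.finrank_self,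
    Module.finrank_fintype_fun_eq_card, Fintype.card_coe] at h1
  have h2 := LinearMap.finrank_range_add_finrank_ker bd
  rw [Module.finrank_fintype_fun_eq_card] at h2
  have h3 := Submodule.finrank_mono hrange
  let δ : (Qφ → (ZMod 2)) →ₗ[(ZMod 2)] (M.Dart → (ZMod 2)) :=
    { toFun := fun c d => c (mkφ (M.rev d)) + c (mkφ d)
      map_add' := fun g g' => by funext v; simp only [Pi.add_apply]; ring
      map_smul' := fun a g => by
        funext v; simp only [Pi.smul_apply, smul_eq_mul, RingHom.id_apply]; ring }
  have h4 := LinearMap.finrank_range_add_finrank_ker δ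
  rw [Module.finrank_fintype_fun_eq_card] at h4
  have h5 : 1 ≤ Module.finrank (ZMod 2) (LinearMap.ker δ) := by
    rw [Nat.one_le_iff_ne_zero, Ne, Submodule.finrank_eq_zero, Submodule.eq_bot_iff]
    intro h
    obtain ⟨d⟩ := ‹Nonempty M.Dart›
    have h' := h (fun _ => 1) (by funext d; exact two 1)
    exact one_ne_zero (congrFun h' (mkφ d))
  have hinj : Function.Injective (LinearMap.funLeft (ZMod 2) (ZMod 2) mkα) :=
    LinearMap.funLeft_injective_of_surjective _ _ _ Quotient.mk_surjective
  have h6 : (LinearMap.ker bd).map (LinearMap.funLeft (ZMod 2) (ZMod 2) mkα) ≤ LinearMap.range δ := by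
    rintro _ ⟨g, hg, rfl⟩
    obtain ⟨c, hc⟩ := M.jordan (fun d => g (mkα d)) (fun d => by rw [hα]) (fun v => by
      by_cases hv : v ∈ univ.image M.src
      · exact congrFun hg ⟨v, hv⟩
      · exact sum_eq_zero fun d hd => absurd
          ((mem_filter.1 hd).2 ▸ mem_image_of_mem _ (mem_univ d)) hv)
    have hf : ∀ d, c (M.next d) = c d := M.face_eq (fun d => by rw [hα]) hc
    refine ⟨Quotient.lift c fun a b h => ?_, ?_⟩
    · exact ((show M.next.SameCycle a b from h).induction (P := fun z => c z = c a) rfl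
        fun z hz => by rw [hf, hz]).symm
    · funext d
      change c (M.rev d) + c d = g (mkα d)
      rw [(hc d).1]
      linear_combination two (c d)
  have h7 := Submodule.finrank_mono h6
  rw [← (Submodule.equivMapOfInjective _ hinj _).finrank_eq] at h7
  have e1 : Fintype.card Qα = Fintype.card (Quotient (Perm.SameCycle.setoid M.rev)) := rfl
  have e2 : Fintype.card Qφ = Fintype.card (Quotient (Perm.SameCycle.setoid M.next)) := rfl
  omega

theorem three_mul_card_add_le [Nonempty M.Dart]
    (hface : ∀ k ∈ Icc 1 4, ∀ d, M.next^[k] d ≠ d) :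
    3 * Fintype.card M.Dart + 20 ≤ 10 * #(univ.image M.src) := by
  have h := M.card_edges_add_two_le
  have h1 : Fintype.card M.Dart ≤ 2 * Fintype.card (Quotient (Perm.SameCycle.setoid M.rev)) := by
    refine card_le_mul_card_image_of_maps_to (f := Quotient.mk (Perm.SameCycle.setoid M.rev))
      (fun _ _ => mem_univ _) 2 fun q _ => ?_
    obtain ⟨d, rfl⟩ := Quotient.mk_surjective q
    refine (card_le_card fun e he => ?_).trans (card_le_two (a := d) (b := M.rev d))
    have he' : M.rev.SameCycle d e := (Quotient.exact (mem_filter.1 he).2).symm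
    refine he'.induction (P := fun e => e ∈ ({d, M.rev d} : Finset M.Dart)) (by simp) ?_
    intro a ha
    rcases mem_insert.1 ha with rfl | ha
    · simp
    · rw [mem_singleton.1 ha, M.rev_rev]; simp
  have h2 : 5 * Fintype.card (Quotient (Perm.SameCycle.setoid M.next)) ≤ Fintype.card M.Dart := by
    refine mul_card_image_le_card_of_maps_to (f := Quotient.mk (Perm.SameCycle.setoid M.next))
      (fun _ _ => mem_univ _) 5 fun q _ => ?_
    obtain ⟨d, rfl⟩ := Quotient.mk_surjective q
    have hinj : Set.InjOn (fun k => M.next^[k] d) (range 5) := by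
      have aux : ∀ i j, i < j → j < 5 → M.next^[i] d ≠ M.next^[j] d := by
        intro i j hij hj he
        obtain ⟨k, rfl⟩ := Nat.exists_eq_add_of_lt hij
        rw [add_assoc, Function.iterate_add_apply] at he
        exact hface (k + 1) (mem_Icc.2 ⟨by omega, by omega⟩) d (M.next.injective.iterate i he).symm
      intro i hi j hj he
      rw [coe_range, Set.mem_Iio] at hi hj
      rcases lt_trichotomy i j with h | h | h
      · exact absurd he (aux i j h hj)
      · exact h
      · exact absurd he.symm (aux j i h hi)
    rw [← card_range 5, ← card_image_of_injOn hinj]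
    refine card_le_card fun e he => ?_
    obtain ⟨k, -, rfl⟩ := mem_image.1 he
    refine mem_filter.2 ⟨mem_univ _, Quotient.sound ?_⟩
    change M.next.SameCycle _ _
    simp only [Perm.iterate_eq_pow]
    exact Perm.sameCycle_pow_left.2 (Perm.SameCycle.refl _ _)
  omega

variable {M} {G : SimpleGraph V}

namespace Exact

theorem adj (hM : M.Exact G) (d : M.Dart) : G.Adj (M.src d) (M.src (M.rev d)) :=
  (hM.adj_iff _ _).2 ⟨d, rfl, rfl⟩

theorem adj_next (hM : M.Exact G) (d : M.Dart) : G.Adj (M.src d) (M.src (M.next d)) := by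
  rw [M.src_next]; exact hM.adj d

theorem next_ne (hM : M.Exact G) (d : M.Dart) : M.next d ≠ d := fun h => by
  have := hM.adj_next d
  rw [h] at this
  exact G.loopless.irrefl _ this

theorem next_next_src_ne (hM : M.Exact G) (hrot : ∀ d, M.rot d ≠ d) (d : M.Dart) :
    M.src d ≠ M.src (M.next (M.next d)) := fun h => by
  refine hrot (M.rev d) (hM.inj _ _ (M.src_rot _) ?_)
  rw [M.rev_rev, h, M.src_next]
  rfl

theorem three_le_face (hM : M.Exact G) (hrot : ∀ d, M.rot d ≠ d)
    (htf : ∀ a b c, G.Adj a b → G.Adj b c → ¬ G.Adj a c) {k : ℕ} (hk : k ∈ Icc 1 3)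
    (d : M.Dart) : M.next^[k] d ≠ d := by
  obtain ⟨h1, h3⟩ := mem_Icc.1 hk
  interval_cases k
  · exact hM.next_ne d
  · intro h
    exact hM.next_next_src_ne hrot d (congrArg M.src h).symm
  · intro h
    refine htf _ _ _ (hM.adj_next d) (hM.adj_next (M.next d)) ?_
    have := hM.adj_next (M.next (M.next d))
    rw [show M.next (M.next (M.next d)) = d from h] at this
    exact this.symm

theorem sum_edge (hM : M.Exact G) {p q : V} (hpq : G.Adj p q) (v : V) :
    ∑ d with M.src d = v, (if s(M.src d, M.src (M.rev d)) = s(p, q) then (1 : ZMod 2) else 0) =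
      (if v = p then 1 else 0) + if v = q then 1 else 0 := by
  have aux : ∀ p q, G.Adj p q → ∑ d with M.src d = p,
      (if s(M.src d, M.src (M.rev d)) = s(p, q) then (1 : ZMod 2) else 0) = 1 := by
    intro p q hpq
    obtain ⟨d, h1, h2⟩ := (hM.adj_iff p q).1 hpq
    rw [sum_eq_single_of_mem d (mem_filter.2 ⟨mem_univ _, h1⟩), if_pos (by rw [h1, h2])]
    intro e he hne
    refine if_neg fun h => hne ?_
    have h3 := (mem_filter.1 he).2
    rw [h3, Sym2.congr_right] at h
    exact hM.inj _ _ (h3.trans h1.symm) (h.trans h2.symm)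
  by_cases h1 : v = p
  · subst h1
    rw [aux v q hpq, if_pos rfl, if_neg hpq.ne, add_zero]
  · by_cases h2 : v = q
    · subst h2
      rw [Sym2.eq_swap (a := p), aux v p hpq.symm, if_neg h1, if_pos rfl, zero_add]
    · rw [if_neg h1, if_neg h2, add_zero]
      refine sum_eq_zero fun d hd => if_neg fun h => ?_
      rw [(mem_filter.1 hd).2] at h
      rcases Sym2.eq_iff.1 h with ⟨h, -⟩ | ⟨h, -⟩
      · exact h1 h
      · exact h2 h

/-- In a triangle-free plane graph, the two pairs of opposite vertices of a quadrangular face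
cannot both be joined by paths of length three. -/
theorem not_crossing_paths (hM : M.Exact G) (htf : ∀ a b c, G.Adj a b → G.Adj b c → ¬ G.Adj a c)
    {d : M.Dart} (hd : M.next^[4] d = d) {v₁ v₂ w₁ w₂ : V}
    (hv₁ : G.Adj (M.src d) v₁) (hv : G.Adj v₁ v₂) (hv₂ : G.Adj v₂ (M.src (M.next (M.next d))))
    (hw₁ : G.Adj (M.src (M.next d)) w₁) (hw : G.Adj w₁ w₂)
    (hw₂ : G.Adj w₂ (M.src (M.next (M.next (M.next d)))))
    (hxz : M.src d ≠ M.src (M.next (M.next d)))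
    (hyu : M.src (M.next d) ≠ M.src (M.next (M.next (M.next d)))) : False := by
  set d₁ := M.next d with hd₁
  set d₂ := M.next d₁ with hd₂
  set d₃ := M.next d₂ with hd₃
  have hd₄ : M.next d₃ = d := hd
  have hxy : G.Adj (M.src d) (M.src d₁) := hM.adj_next d
  have hyz : G.Adj (M.src d₁) (M.src d₂) := hM.adj_next d₁
  have hzu : G.Adj (M.src d₂) (M.src d₃) := hM.adj_next d₂
  have hux : G.Adj (M.src d₃) (M.src d) := hd₄ ▸ hM.adj_next d₃
  set x := M.src d
  set y := M.src d₁
  set z := M.src d₂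
  set u := M.src d₃
  have symm : ∀ {a b}, G.Adj a b → G.Adj b a := fun h => h.symm
  let K : Finset V := {x, y, z, v₂, v₁}
  have hu : u ∉ K := by
    simp only [K, mem_insert, mem_singleton, not_or]
    exact ⟨hux.ne, hyu.symm, hzu.ne', fun h => htf _ _ _ hux hv₁ (h ▸ hv.symm),
      fun h => htf _ _ _ hzu (h ▸ hv) hv₂.symm⟩
  have hw₁K : w₁ ∉ K := by
    simp only [K, mem_insert, mem_singleton, not_or]
    exact ⟨fun h => htf _ _ _ hw₂ hux (h ▸ hw.symm), hw₁.ne',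
      fun h => htf _ _ _ hw₂ hzu.symm (h ▸ hw.symm), fun h => htf _ _ _ hw₁ (h ▸ hv₂) hyz,
      fun h => htf _ _ _ hxy hw₁ (h ▸ hv₁)⟩
  have hw₂K : w₂ ∉ K := by
    simp only [K, mem_insert, mem_singleton, not_or]
    exact ⟨fun h => htf _ _ _ hw₁ (h ▸ hw) hxy.symm, fun h => htf _ _ _ hux hxy (h ▸ hw₂.symm),
      fun h => htf _ _ _ hw₁ (h ▸ hw) hyz, fun h => htf _ _ _ hzu hw₂.symm (h ▸ hv₂.symm),
      fun h => htf _ _ _ hw₂ hux (h ▸ hv₁.symm)⟩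
  have hyv₁ : y ≠ v₁ := fun h => htf _ _ _ hyz hv₂.symm (h ▸ hv)
  have hyv₂ : y ≠ v₂ := fun h => htf _ _ _ hxy (h ▸ hv.symm) hv₁
  let i : V → V → M.Dart → ZMod 2 := fun p q t =>
    if s(M.src t, M.src (M.rev t)) = s(p, q) then 1 else 0
  have hi : ∀ p q t, M.src t ≠ p → M.src t ≠ q → i p q t = 0 := fun p q t h1 h2 =>
    if_neg fun h => (Sym2.eq_iff.1 h).elim (fun h => h1 h.1) fun h => h2 h.1
  let C : M.Dart → ZMod 2 := fun t => i x y t + i y z t + i z v₂ t + i v₂ v₁ t + i v₁ x t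
  have hC : ∀ t, C (M.rev t) = C t := fun t => by
    simp only [C, i, M.rev_rev, Sym2.eq_swap (a := M.src (M.rev t))]
  have two : ∀ a : ZMod 2, a + a = 0 := CharTwo.add_self_eq_zero
  obtain ⟨c, hc⟩ := M.jordan C hC fun v => by
    simp only [C, i, sum_add_distrib]
    rw [hM.sum_edge hxy, hM.sum_edge hyz, hM.sum_edge hv₂.symm, hM.sum_edge hv.symm,
      hM.sum_edge hv₁.symm]
    linear_combination two (if v = x then 1 else 0) + two (if v = y then 1 else 0) +
      two (if v = z then 1 else 0) + two (if v = v₂ then 1 else 0) +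
      two (if v = v₁ then 1 else 0)
  have hface : ∀ t, c (M.next t) = c t := M.face_eq hC hc
  have hC0 : ∀ t, M.src t ∉ K → C t = 0 := fun t ht => by
    simp only [K, mem_insert, mem_singleton, not_or] at ht
    obtain ⟨h1, h2, h3, h4, h5⟩ := ht
    simp only [C, hi _ _ _ h1 h2, hi _ _ _ h2 h3, hi _ _ _ h3 h4, hi _ _ _ h4 h5, hi _ _ _ h5 h1,
      add_zero]
  have hvert : ∀ s t, M.src s ∉ K → M.src s = M.src t → c t = c s := fun s t hs hst =>
    ((M.sameCycle s t hst).induction (P := fun t => M.src t = M.src s ∧ c t = c s) ⟨rfl, rfl⟩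
      fun a ha => ⟨(M.src_rot a).trans ha.1, by
        rw [(hc a).2, ha.2, hC0 a (ha.1 ▸ hs), add_zero]⟩).2
  have hedge : ∀ t, M.src t ∉ K → c (M.rev t) = c t := fun t ht => by
    rw [(hc t).1, hC0 t ht, add_zero]
  obtain ⟨e₂, he₂, he₂'⟩ := (hM.adj_iff _ _).1 hw₂.symm
  obtain ⟨e₁, he₁, he₁'⟩ := (hM.adj_iff _ _).1 hw.symm
  obtain ⟨e₀, he₀, he₀'⟩ := (hM.adj_iff _ _).1 hw₁.symm
  have hce : c (M.rev e₀) = c d₁ := by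
    rw [hedge e₀ (he₀ ▸ hw₁K), hvert (M.rev e₁) e₀ (he₁' ▸ hw₁K) (he₁'.trans he₀.symm),
      hedge e₁ (he₁ ▸ hw₂K), hvert (M.rev e₂) e₁ (he₂' ▸ hw₂K) (he₂'.trans he₁.symm),
      hedge e₂ (he₂ ▸ hu), hvert d₃ e₂ hu he₂.symm, hface, hface]
  have hCy : ∀ t, M.src t = y → C t = i x y t + i y z t := fun t ht => by
    simp only [C, hi z v₂ t (ht ▸ hyz.ne) (ht ▸ hyv₂), hi v₂ v₁ t (ht ▸ hyv₂) (ht ▸ hyv₁),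
      hi v₁ x t (ht ▸ hyv₁) (ht ▸ hxy.ne'), add_zero]
  have hrd : M.src (M.rev d) = y := (M.src_next d).symm
  have hrd₁ : M.src (M.rev d₁) = z := (M.src_next d₁).symm
  have key := ((M.sameCycle d₁ (M.rev e₀) he₀'.symm).induction
    (P := fun t => M.src t = y ∧ (t = d₁ ∨ c t = c d₁ + 1)) ⟨rfl, Or.inl rfl⟩ ?_).2
  · rcases key with h | h
    · rw [← h, M.rev_rev, he₀] at hrd₁
      exact hw₁K (by simp [K, hrd₁])
    · rw [hce] at h
      exact one_ne_zero (left_eq_add.1 h)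
  · rintro t ⟨ht, hct⟩
    refine ⟨(M.src_rot t).trans ht, ?_⟩
    by_cases h1 : t = d₁
    · right
      have h2 : i x y d₁ = 0 := if_neg fun h => by
        rw [hrd₁, Sym2.eq_swap, Sym2.congr_left] at h
        exact hxz h.symm
      have h3 : i y z d₁ = 1 := if_pos (by rw [hrd₁])
      rw [h1, (hc d₁).2, hCy d₁ rfl, h2, h3, zero_add]
    · by_cases h2 : t = M.rev d
      · exact Or.inl (h2 ▸ rfl)
      · right
        have h3 : i x y t = 0 := if_neg fun h => by
          rw [ht, Sym2.eq_swap, Sym2.congr_left] at h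
          exact h2 (hM.inj _ _ (ht.trans hrd.symm) (by rw [h, M.rev_rev]))
        have h4 : i y z t = 0 := if_neg fun h => by
          rw [ht, Sym2.congr_right] at h
          exact h1 (hM.inj _ _ ht (h.trans hrd₁.symm))
        rw [(hc t).2, hCy t ht, h3, h4, add_zero, add_zero]
        exact hct.resolve_left h1

end Exact

end PlaneMap

theorem SimpleGraph.MapPlanar.exists_exact {G : SimpleGraph V} (hG : G.MapPlanar) :
    ∃ M : PlaneMap V, M.Exact G := by
  obtain ⟨M, hM⟩ := hG
  have hex : ∀ e : G.edgeSet, ∃ d, s(M.src d, M.src (M.rev d)) = e := by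
    rintro ⟨e, he⟩
    induction e using Sym2.ind with
    | _ u v =>
      obtain ⟨d, rfl, rfl⟩ := hM u v he
      exact ⟨d, rfl⟩
  choose rep hrep using hex
  let L : Finset M.Dart := {d | ∃ e, d = rep e ∨ M.rev d = rep e}
  have hL : ∀ d, d ∈ L ↔ ∃ e, d = rep e ∨ M.rev d = rep e := fun d => by simp [L]
  have hedge : ∀ d e, (d = rep e ∨ M.rev d = rep e) → s(M.src d, M.src (M.rev d)) = e := by
    rintro d e (rfl | h)
    · exact hrep e
    · rw [← hrep e, ← h, M.rev_rev, Sym2.eq_swap]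
  obtain ⟨M', ι, hι, hιL, hsrc, hrev⟩ := PlaneMap.exists_restrict M.rot M.rev M.src L M.rev_rev
    M.rev_ne (fun d hd => by
      obtain ⟨e, h⟩ := (hL d).1 hd
      exact (hL _).2 ⟨e, by rw [M.rev_rev]; exact h.symm⟩) M.src_rot
    (fun d _ e _ h => by
      obtain ⟨i, hi, -, h⟩ := (M.sameCycle d e h).exists_pow_eq''
      refine ⟨i - 1, ?_⟩
      rw [Nat.sub_add_cancel hi, Perm.iterate_eq_pow, h])
    (fun C h0 hC hs => M.jordan C hC fun v => by
      rw [← hs v, sum_filter, sum_filter]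
      refine (sum_subset (subset_univ L) fun d _ hd => ?_).symm
      rw [h0 d hd, ite_self])
  refine ⟨M', fun d e h1 h2 => hι ?_, fun u v => ⟨fun h => ?_, ?_⟩⟩
  · rw [hsrc, hsrc] at h1
    rw [hsrc, hsrc, hrev, hrev] at h2
    obtain ⟨a, ha⟩ := (hL _).1 ((hιL (ι d)).2 ⟨d, rfl⟩)
    obtain ⟨b, hb⟩ := (hL _).1 ((hιL (ι e)).2 ⟨e, rfl⟩)
    have hab : a = b := Subtype.ext (by rw [← hedge _ _ ha, ← hedge _ _ hb, h1, h2])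
    subst hab
    have hne : M.src (ι e) ≠ M.src (M.rev (ι e)) := by
      have := a.2
      rw [← hedge _ _ hb] at this
      exact G.ne_of_adj this
    rcases ha with ha | ha <;> rcases hb with hb | hb
    · rw [ha, hb]
    · exact absurd (by rw [← h1, ha, hb]) hne
    · exact absurd (by rw [← h2, ha, hb]) hne
    · exact M.rev.injective (by rw [ha, hb])
  · have hs := hrep ⟨s(u, v), h⟩
    rcases Sym2.eq_iff.1 hs with ⟨h1, h2⟩ | ⟨h1, h2⟩
    · obtain ⟨x, hx⟩ := (hιL _).1 ((hL _).2 ⟨⟨s(u, v), h⟩, Or.inl rfl⟩)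
      exact ⟨x, by rw [hsrc, hx, h1], by rw [hsrc, hrev, hx, h2]⟩
    · obtain ⟨x, hx⟩ := (hιL _).1 ((hL _).2 ⟨⟨s(u, v), h⟩, Or.inr (M.rev_rev _)⟩)
      exact ⟨x, by rw [hsrc, hx, h2], by rw [hsrc, hrev, hx, M.rev_rev, h1]⟩
  · rintro ⟨d, rfl, rfl⟩
    obtain ⟨a, ha⟩ := (hL _).1 ((hιL (ι d)).2 ⟨d, rfl⟩)
    have := a.2
    rw [← hedge _ _ ha] at this
    rw [hsrc, hsrc, hrev]
    exact this

end Faces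

section Assembly

open Finset
open scoped Classical

theorem SimpleGraph.MapPlanar.of_le {G G' : SimpleGraph V} (hG : G.MapPlanar) (h : G' ≤ G) :
    G'.MapPlanar :=
  let ⟨M, hM⟩ := hG
  ⟨M, fun u v huv => hM u v (h huv)⟩

theorem SimpleGraph.map_update_adj {G : SimpleGraph V} {x z a b : V}
    (h : (G.map (Function.update id z x)).Adj a b) :
    a ≠ b ∧ (G.Adj a b ∨ (a = x ∧ G.Adj z b) ∨ (b = x ∧ G.Adj z a)) := by
  obtain ⟨hne, p, q, hpq, rfl, rfl⟩ := h
  refine ⟨hne, ?_⟩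
  by_cases hp : p = z
  · subst hp
    have hq : q ≠ p := hpq.ne'
    simp [hq, hpq]
  · by_cases hq : q = z
    · subst hq
      simp [hp, hpq.symm]
    · simp [hp, hq, hpq]

theorem SimpleGraph.map_update_triangleFree {G : SimpleGraph V}
    (htf : ∀ a b c, G.Adj a b → G.Adj b c → ¬ G.Adj a c) {x z : V}
    (hno : ∀ v₁ v₂, G.Adj x v₁ → G.Adj v₁ v₂ → ¬ G.Adj v₂ z) (a b c : V)
    (hab : (G.map (Function.update id z x)).Adj a b)
    (hbc : (G.map (Function.update id z x)).Adj b c) :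
    ¬ (G.map (Function.update id z x)).Adj a c := by
  intro hac
  obtain ⟨nab, hab⟩ := map_update_adj hab
  obtain ⟨nbc, hbc⟩ := map_update_adj hbc
  obtain ⟨nac, hac⟩ := map_update_adj hac
  have symm : ∀ p q, G.Adj p q → G.Adj q p := fun p q h => h.symm
  grind

namespace PlaneMap.Exact

variable {M : PlaneMap V} {G : SimpleGraph V}

/-- Opposite vertices of a quadrangular face can be identified. -/
theorem mapPlanar_map_update (hM : M.Exact G) (hrot : ∀ d, M.rot d ≠ d) {d : M.Dart}
    (hd : M.next^[4] d = d) :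
    (G.map (Function.update id (M.src (M.next (M.next d))) (M.src d))).MapPlanar := by
  have h1 : M.next d ≠ d := hM.next_ne d
  have h2 : M.next (M.next d) ≠ M.next d := hM.next_ne _
  have h3 := hM.next_next_src_ne hrot d
  have h4 : M.next (M.next d) ≠ d := fun h => h3 (congrArg M.src h).symm
  refine ⟨M.merge (d := d) (e := M.next (M.next d)) (W := {d, M.next d}) (by simp)
    (by simp [h2, h4]) (fun a ha => ?_) h3 (fun c hc => ?_), ?_⟩
  · change Equiv.swap d (M.next (M.next d)) (M.next a) ∈ _
    rcases mem_insert.1 ha with rfl | ha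
    · rw [Equiv.swap_apply_of_ne_of_ne h1 h2.symm]; simp
    · rw [mem_singleton.1 ha, Equiv.swap_apply_right]; simp
  · exact ((hc (M.next d)).trans (hc d)).symm
  · rintro _ _ ⟨-, p, q, hpq, rfl, rfl⟩
    obtain ⟨t, rfl, rfl⟩ := (hM.adj_iff p q).1 hpq
    refine ⟨t, ?_, ?_⟩ <;> simp only [Function.update_apply, id] <;> rfl

theorem colorableOn_of_quadrangle [Fintype V] {H : SimpleGraph V} {h : V}
    (ih : ∀ H' : SimpleGraph V,
      #{p : V × V | H'.Adj p.1 p.2} < #{p : V × V | H.Adj p.1 p.2} → #{w | H'.Adj h w} ≤ 4 →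
      (H'.deleteIncidenceSet h).MapPlanar →
      (∀ a b c, (H'.deleteIncidenceSet h).Adj a b → (H'.deleteIncidenceSet h).Adj b c →
        ¬ (H'.deleteIncidenceSet h).Adj a c) → H'.ColorableOn univ)
    (hdeg : #{w | H.Adj h w} ≤ 4) (hM : M.Exact (H.deleteIncidenceSet h))
    (htf : ∀ a b c, (H.deleteIncidenceSet h).Adj a b → (H.deleteIncidenceSet h).Adj b c →
      ¬ (H.deleteIncidenceSet h).Adj a c)
    (hrot : ∀ d, M.rot d ≠ d) {d : M.Dart} (hd : M.next^[4] d = d)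
    (hno : ∀ v₁ v₂, (H.deleteIncidenceSet h).Adj (M.src d) v₁ →
      (H.deleteIncidenceSet h).Adj v₁ v₂ →
      ¬ (H.deleteIncidenceSet h).Adj v₂ (M.src (M.next (M.next d)))) :
    H.ColorableOn univ := by
  have hpl := hM.mapPlanar_map_update hrot hd
  have hxz := hM.next_next_src_ne hrot d
  have hxy := hM.adj_next d
  have hyz := hM.adj_next (M.next d)
  set x := M.src d
  set y := M.src (M.next d)
  set z := M.src (M.next (M.next d))
  have hnxz := htf _ _ _ hxy hyz
  have htf' := SimpleGraph.map_update_triangleFree htf hno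
  rw [SimpleGraph.deleteIncidenceSet_adj] at hxy hyz hnxz
  obtain ⟨hxy, hxh, -⟩ := hxy
  obtain ⟨hyz, -, hzh⟩ := hyz
  set r : V → V := Function.update id z x
  have hrz : r z = x := Function.update_self ..
  have hrn : ∀ {v}, v ≠ z → r v = v := fun hv => Function.update_of_ne hv ..
  have hrh : ∀ {v}, r v = h → v = h := fun {v} hv => by
    by_cases hvz : v = z
    · rw [hvz, hrz] at hv; exact absurd hv hxh
    · rwa [hrn hvz] at hv
  obtain ⟨H', hH'⟩ : ∃ H', H' = H.map r := ⟨_, rfl⟩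
  have hle : H'.deleteIncidenceSet h ≤ (H.deleteIncidenceSet h).map r := by
    intro a b hab
    rw [SimpleGraph.deleteIncidenceSet_adj, hH'] at hab
    obtain ⟨⟨hne, p, q, hpq, rfl, rfl⟩, ha, hb⟩ := hab
    refine ⟨hne, p, q, ?_, rfl, rfl⟩
    rw [SimpleGraph.deleteIncidenceSet_adj]
    exact ⟨hpq, fun hp => ha (by rw [hp, hrn hzh.symm]), fun hq => hb (by rw [hq, hrn hzh.symm])⟩
  have ih := ih H' ?_ ?_ (hpl.of_le hle)
    fun a b c h1 h2 h3 => htf' a b c (hle h1) (hle h2) (hle h3)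
  · obtain ⟨c, hc⟩ := ih
    refine ⟨c ∘ r, fun a _ b _ hab => hc _ (mem_univ _) _ (mem_univ _)
      (hH' ▸ SimpleGraph.map_adj_apply' hab fun hrab => ?_)⟩
    by_cases ha : a = z
    · subst ha
      rw [hrz, hrn hab.ne'] at hrab
      exact hnxz ⟨hrab ▸ hab.symm, hxh, hzh⟩
    · by_cases hb : b = z
      · subst hb
        rw [hrz, hrn ha] at hrab
        exact hnxz ⟨hrab ▸ hab, hxh, hzh⟩
      · rw [hrn ha, hrn hb] at hrab
        exact hab.ne hrab
  · have hmem : (y, z) ∈ ({p : V × V | H.Adj p.1 p.2} : Finset _) := by simpa using hyz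
    rw [← card_erase_add_one hmem, Nat.lt_add_one_iff]
    refine (card_le_card fun p hp => ?_).trans (card_image_le (f := Prod.map r r))
    obtain ⟨a, b⟩ := p
    obtain ⟨hne, p, q, hpq, rfl, rfl⟩ := hH' ▸ (mem_filter.1 hp).2
    by_cases hpqe : (p, q) = (y, z)
    · obtain ⟨rfl, rfl⟩ := Prod.mk.inj hpqe
      refine mem_image.2 ⟨(y, x), ?_, ?_⟩
      · simp [hxz, hxy.symm]
      · simp [hrz, hrn hxz]
    · exact mem_image.2 ⟨(p, q), mem_erase.2 ⟨hpqe, by simpa using hpq⟩, rfl⟩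
  · refine ((card_le_card fun w hw => ?_).trans (card_image_le (f := r))).trans hdeg
    obtain ⟨hne, p, q, hpq, hp, rfl⟩ := hH' ▸ (mem_filter.1 hw).2
    obtain rfl := hrh hp
    exact mem_image_of_mem _ (by simpa using hpq)

end PlaneMap.Exact

theorem SimpleGraph.colorableOn_univ_of_mapPlanar [Fintype V] (h : V) (H : SimpleGraph V)
    (hdeg : #{w | H.Adj h w} ≤ 4) (hpl : (H.deleteIncidenceSet h).MapPlanar)
    (htf : ∀ a b c, (H.deleteIncidenceSet h).Adj a b → (H.deleteIncidenceSet h).Adj b c →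
      ¬ (H.deleteIncidenceSet h).Adj a c) : H.ColorableOn univ := by
  induction hn : #{p : V × V | H.Adj p.1 p.2} using Nat.strong_induction_on generalizing H with
  | _ n ih =>
  subst hn
  replace ih := fun (H' : SimpleGraph V) hlt hdeg' hpl' htf' => ih _ hlt H' hdeg' hpl' htf' rfl
  by_contra hcol
  obtain ⟨S, -, hS⟩ := exists_criticalOn hcol
  have hin : ∀ a b, H.Adj a b → a ∈ S := by
    by_contra! hout
    obtain ⟨a, b, hab, ha⟩ := hout
    have hle : H.deleteIncidenceSet a ≤ H := H.deleteIncidenceSet_le a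
    have hle' : (H.deleteIncidenceSet a).deleteIncidenceSet h ≤ H.deleteIncidenceSet h := by
      intro p q hpq
      rw [deleteIncidenceSet_adj] at hpq ⊢
      exact ⟨hle hpq.1, hpq.2⟩
    have := ih (H.deleteIncidenceSet a) (card_lt_card ?_)
      ((card_le_card fun w hw => ?_).trans hdeg) (hpl.of_le hle')
      fun a b c h1 h2 h3 => htf a b c (hle' h1) (hle' h2) (hle' h3)
    · refine hS.1 ((this.mono (subset_univ S)).of_le fun p hp q hq hpq => ?_)
      rw [deleteIncidenceSet_adj]
      exact ⟨hpq, fun h => ha (h ▸ hp), fun h => ha (h ▸ hq)⟩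
    · refine Finset.ssubset_iff_of_subset (fun p hp => ?_) |>.2 ⟨(a, b), by simpa using hab, ?_⟩
      · simp only [mem_filter, mem_univ, true_and] at hp ⊢
        exact hle hp
      · simp [deleteIncidenceSet_adj]
    · simp only [mem_filter, mem_univ, true_and] at hw ⊢
      exact hle hw
  obtain ⟨M, hM⟩ := hpl.exists_exact
  have hrot : ∀ d, M.rot d ≠ d := by
    intro d hd
    have hadj := (deleteIncidenceSet_adj.1 (hM.adj d))
    have h3 := hS.three_le_degree (hin _ _ hadj.1)
    have hsub : ({w ∈ S | H.Adj (M.src d) w} : Finset V) ⊆ {h, M.src (M.rev d)} := by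
      intro w hw
      by_cases hwh : w = h
      · simp [hwh]
      · obtain ⟨t, ht, rfl⟩ := (hM.adj_iff _ _).1
          (deleteIncidenceSet_adj.2 ⟨(mem_filter.1 hw).2, hadj.2.1, hwh⟩)
        have : t = d := (M.sameCycle d t ht.symm).induction (P := fun t => t = d) rfl
          fun a ha => ha ▸ hd
        simp [this]
    have := (card_le_card hsub).trans card_le_two
    omega
  have h4 := four_le_card_of_not_colorableOn hS.1
  have : Nonempty M.Dart := by
    obtain ⟨x, hx⟩ : (S.erase h).Nonempty := card_pos.1 (by
      have := pred_card_le_card_erase (s := S) (a := h)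
      omega)
    obtain ⟨hxh, hx⟩ := mem_erase.1 hx
    have h3 := hS.three_le_degree hx
    obtain ⟨w, hw⟩ : (({w ∈ S | H.Adj x w} : Finset V).erase h).Nonempty := card_pos.1 (by
      have := pred_card_le_card_erase (s := ({w ∈ S | H.Adj x w} : Finset V)) (a := h)
      omega)
    simp only [mem_erase, mem_filter] at hw
    obtain ⟨t, -⟩ := (hM.adj_iff _ _).1 (deleteIncidenceSet_adj.2 ⟨hw.2.2, hxh, hw.1⟩)
    exact ⟨t⟩
  by_cases hquad : ∃ d, M.next^[4] d = d
  · obtain ⟨d, hd⟩ := hquad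
    by_cases hxz : ∃ v₁ v₂, (H.deleteIncidenceSet h).Adj (M.src d) v₁ ∧
        (H.deleteIncidenceSet h).Adj v₁ v₂ ∧
        (H.deleteIncidenceSet h).Adj v₂ (M.src (M.next (M.next d)))
    · obtain ⟨v₁, v₂, hv₁, hv, hv₂⟩ := hxz
      refine hcol (hM.colorableOn_of_quadrangle ih hdeg htf hrot (d := M.next d) ?_ ?_)
      · rw [← Function.iterate_succ_apply, Function.iterate_succ_apply', hd]
      · exact fun w₁ w₂ hw₁ hw hw₂ => hM.not_crossing_paths htf hd hv₁ hv hv₂ hw₁ hw hw₂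
          (hM.next_next_src_ne hrot _) (hM.next_next_src_ne hrot _)
    · push Not at hxz
      exact hcol (hM.colorableOn_of_quadrangle ih hdeg htf hrot hd hxz)
  · have hface := M.three_mul_card_add_le fun k hk d => by
      by_cases h4 : k = 4
      · exact fun hd => hquad ⟨d, h4 ▸ hd⟩
      · have := mem_Icc.1 hk
        exact hM.three_le_face hrot htf (mem_Icc.2 ⟨this.1, by omega⟩) d
    have hedges : H.adjCount S S ≤ Fintype.card M.Dart + 2 * #{w | H.Adj h w} := by
      have h1 : H.adjCount S S ≤ #{p : V × V | H.Adj p.1 p.2} := by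
        rw [adjCount, ← sum_product', sum_boole]
        exact_mod_cast card_le_card (filter_subset_filter _ (subset_univ _))
      have h2 : ({p : V × V | H.Adj p.1 p.2} : Finset _) ⊆
          univ.image (fun d => (M.src d, M.src (M.rev d))) ∪
            (({w | H.Adj h w} : Finset V).image (Prod.mk h) ∪
              ({w | H.Adj h w} : Finset V).image (fun w => (w, h))) := by
        rintro ⟨a, b⟩ hab
        have hab : H.Adj a b := by simpa using hab
        simp only [mem_union, mem_image, mem_univ, true_and, mem_filter]
        by_cases ha : a = h
        · exact Or.inr (Or.inl ⟨b, ha ▸ hab, by rw [ha]⟩)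
        · by_cases hb : b = h
          · exact Or.inr (Or.inr ⟨a, hb ▸ hab.symm, by rw [hb]⟩)
          · obtain ⟨t, rfl, rfl⟩ := (hM.adj_iff _ _).1 (deleteIncidenceSet_adj.2 ⟨hab, ha, hb⟩)
            exact Or.inl ⟨t, rfl⟩
      have h3 := ((card_le_card h2).trans (card_union_le _ _)).trans
        (add_le_add card_image_le ((card_union_le _ _).trans
          (add_le_add card_image_le card_image_le)))
      rw [card_univ] at h3
      omega
    have himage : univ.image M.src ⊆ S.erase h := by
      intro v hv
      obtain ⟨d, -, rfl⟩ := mem_image.1 hv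
      have := deleteIncidenceSet_adj.1 (hM.adj d)
      exact mem_erase.2 ⟨this.2.1, hin _ _ this.1⟩
    have himage := card_le_card himage
    have hpot := hS.potential_le
    unfold potential at hpot
    by_cases hhS : h ∈ S
    · have := card_erase_add_one hhS
      omega
    · have h0 : #{w | H.Adj h w} = 0 := card_eq_zero.2
        (filter_eq_empty_iff.2 fun w _ hw => hhS (hin _ _ hw))
      rw [erase_eq_of_notMem hhS] at himage
      omega

end Assembly

/-- If deleting a vertex of degree at most 4 from `H` yields a planar triangle-free graph,
then `H` is 3-colorable. -/
theorem three_colorable_of_deleteVertex_planar_triangleFree [Fintype V]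
    (H : SimpleGraph V) [DecidableRel H.Adj] (v : V) (hdeg : H.degree v ≤ 4)
    (hplanar : (H.induce ({v}ᶜ : Set V)).IsPlanar)
    (htf : (H.induce ({v}ᶜ : Set V)).CliqueFree 3) : H.Colorable 3 := by
  classical
  obtain ⟨M, hM⟩ := hplanar.mapPlanar
  obtain ⟨c, hc⟩ := SimpleGraph.colorableOn_univ_of_mapPlanar v H
    (by
      rw [← H.card_neighborFinset_eq_degree, H.neighborFinset_eq_filter] at hdeg
      convert hdeg)
    ⟨M.relabel Subtype.val fun _ _ h => Subtype.ext h, fun a b hab => by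
      obtain ⟨hab, ha, hb⟩ := SimpleGraph.deleteIncidenceSet_adj.1 hab
      obtain ⟨d, h1, h2⟩ := hM ⟨a, ha⟩ ⟨b, hb⟩ hab
      exact ⟨d, congrArg Subtype.val h1, congrArg Subtype.val h2⟩⟩
    (fun a b c hab hbc hac => by
      obtain ⟨hab, ha, hb⟩ := SimpleGraph.deleteIncidenceSet_adj.1 hab
      obtain ⟨hbc, -, hc⟩ := SimpleGraph.deleteIncidenceSet_adj.1 hbc
      obtain ⟨hac, -⟩ := SimpleGraph.deleteIncidenceSet_adj.1 hac
      exact htf {⟨a, ha⟩, ⟨b, hb⟩, ⟨c, hc⟩}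
        (SimpleGraph.is3Clique_triple_iff.2 ⟨SimpleGraph.induce_adj.2 hab,
          SimpleGraph.induce_adj.2 hac, SimpleGraph.induce_adj.2 hbc⟩))
  exact ⟨SimpleGraph.Coloring.mk c fun {a b} hab =>
    hc a (Finset.mem_univ a) b (Finset.mem_univ b) hab⟩
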